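/- Let B be an even simple Bratteli diagram with full group G=G_B and path space X=X_B, and suppose (X,G) admits only finitely many ergodic G-invariant Borel probability measures. Then for every character χ of G there exists a unique invariant random subgroup φ of G such that χ(g)=φ({H∈Sub(G) : g∈H}) for every g∈G. -/

import Mathlib

open MeasureTheory Filter
open scoped ENNReal ComplexOrder

noncomputable section

/-- A Bratteli diagram: vertex levels `V i`, edge levels `E i` (edges from `V i` to `V (i+1)`),
all levels finite and nonempty, a single root vertex, and source/range maps that are
surjective (every vertex emits and receives an edge). -/
structure BratteliDiagram where
  V : ℕ → Type
  E : ℕ → Type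
  fintypeV : ∀ i, Fintype (V i)
  fintypeE : ∀ i, Fintype (E i)
  nonemptyV : ∀ i, Nonempty (V i)
  nonemptyE : ∀ i, Nonempty (E i)
  subsingleton_root : Subsingleton (V 0)
  src : ∀ i, E i → V i
  rng : ∀ i, E i → V (i + 1)
  src_surj : ∀ i, Function.Surjective (src i)
  rng_surj : ∀ i, Function.Surjective (rng i)

namespace BratteliDiagram

variable (B : BratteliDiagram)

/-- The path space `X_B`: infinite paths starting at the root. -/
def Path : Type :=
  { x : ∀ i, B.E i // ∀ i, B.rng i (x i) = B.src (i + 1) (x (i + 1)) }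

instance (i : ℕ) : UniformSpace (B.E i) := ⊥

instance instUniformSpacePath : UniformSpace B.Path :=
  inferInstanceAs (UniformSpace { x : ∀ i, B.E i // ∀ i, B.rng i (x i) = B.src (i + 1) (x (i + 1)) })

instance instMeasurableSpacePath : MeasurableSpace B.Path := borel _

/-- Finite segments of `L+1` consecutive edges starting at level `n`. -/
def Seg (n L : ℕ) : Type :=
  { f : ∀ i : Fin (L + 1), B.E (n + (i : ℕ)) //
    ∀ (i : ℕ) (hi : i < L),
      B.rng (n + i) (f ⟨i, by omega⟩) = B.src (n + (i + 1)) (f ⟨i + 1, by omega⟩) }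

/-- The number of finite paths connecting `v ∈ V n` to `w ∈ V (n + L + 1)`. -/
def numPaths (n L : ℕ) (v : B.V n) (w : B.V (n + L + 1)) : ℕ :=
  Nat.card { f : B.Seg n L //
    B.src n (f.1 ⟨0, by omega⟩) = v ∧ B.rng (n + L) (f.1 ⟨L, by omega⟩) = w }

/-- A Bratteli diagram is simple if every vertex of a given level is connected
to every vertex of some deeper level. -/
def IsSimple : Prop :=
  ∀ n : ℕ, ∃ L : ℕ, ∀ (v : B.V n) (w : B.V (n + L + 1)), 0 < B.numPaths n L v w

/-- A Bratteli diagram is even if every vertex of a given level is connected to every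
vertex of some deeper level by a (positive) even number of paths. -/
def IsEven : Prop :=
  ∀ n : ℕ, ∃ L : ℕ, ∀ (v : B.V n) (w : B.V (n + L + 1)),
    0 < B.numPaths n L v w ∧ Even (B.numPaths n L v w)

/-- A permutation of the path space "of level `n`": it changes only the first `n` edges,
and what it does to the first `n` edges depends only on the first `n` edges. -/
def IsLevel (n : ℕ) (g : Equiv.Perm B.Path) : Prop :=
  (∀ (x : B.Path) (i : ℕ), n ≤ i → (g x).1 i = x.1 i) ∧
  (∀ x y : B.Path, (∀ i : ℕ, i < n → x.1 i = y.1 i) → ∀ i : ℕ, i < n → (g x).1 i = (g y).1 i)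

theorem isLevel_one (n : ℕ) : B.IsLevel n 1 :=
  ⟨fun _ _ _ => rfl, fun _ _ h i hi => h i hi⟩

theorem IsLevel.mul {n : ℕ} {a b : Equiv.Perm B.Path} (ha : B.IsLevel n a)
    (hb : B.IsLevel n b) : B.IsLevel n (a * b) := by
  constructor
  · intro x i hi
    have h1 := ha.1 (b x) i hi
    have h2 := hb.1 x i hi
    simpa [Equiv.Perm.mul_apply] using h1.trans h2
  · intro x y hxy i hi
    have h2 := hb.2 x y hxy
    have := ha.2 (b x) (b y) h2 i hi
    simpa [Equiv.Perm.mul_apply] using this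

theorem IsLevel.mono {n m : ℕ} (hnm : n ≤ m) {g : Equiv.Perm B.Path}
    (h : B.IsLevel n g) : B.IsLevel m g := by
  refine ⟨fun x i hi => h.1 x i (hnm.trans hi), fun x y hxy i hi => ?_⟩
  rcases lt_or_ge i n with h' | h'
  · exact h.2 x y (fun j hj => hxy j (hj.trans_le hnm)) i h'
  · rw [h.1 x i h', h.1 y i h']
    exact hxy i hi

/-- The group `G_n` of homeomorphisms of the path space permuting only the
first `n` edges of infinite paths. -/
def level (n : ℕ) : Subgroup (Equiv.Perm B.Path) where
  carrier := { g | B.IsLevel n g ∧ B.IsLevel n g⁻¹ }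
  one_mem' := ⟨B.isLevel_one n, by simpa using B.isLevel_one n⟩
  mul_mem' := by
    intro a b ha hb
    exact ⟨ha.1.mul B hb.1, by rw [mul_inv_rev]; exact IsLevel.mul B hb.2 ha.2⟩
  inv_mem' := by
    intro a ha
    exact ⟨ha.2, by simpa using ha.1⟩

theorem level_mono {n m : ℕ} (h : n ≤ m) : B.level n ≤ B.level m := by
  intro g hg
  exact ⟨hg.1.mono B h, hg.2.mono B h⟩

/-- The full group `G_B = ⋃ n, G_n` of the Bratteli diagram. -/
def fullGroup : Subgroup (Equiv.Perm B.Path) where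
  carrier := { g | ∃ n, g ∈ B.level n }
  one_mem' := ⟨0, one_mem _⟩
  mul_mem' := by
    rintro a b ⟨n, ha⟩ ⟨m, hb⟩
    exact ⟨max n m, mul_mem (B.level_mono (le_max_left n m) ha)
      (B.level_mono (le_max_right n m) hb)⟩
  inv_mem' := by
    rintro a ⟨n, ha⟩
    exact ⟨n, inv_mem ha⟩

/-- `G_n` viewed as a subgroup of the full group. -/
def levelIn (n : ℕ) : Subgroup ↥B.fullGroup := (B.level n).comap B.fullGroup.subtype

/-- The subgroup `G°(A)` of elements of the full group fixing `A` pointwise. -/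
def Gcirc (A : Set B.Path) : Subgroup ↥B.fullGroup :=
  ⨅ x ∈ A, MulAction.stabilizer ↥B.fullGroup x

/-- `G°_n(A) = G_n ∩ G°(A)`. -/
def GcircN (n : ℕ) (A : Set B.Path) : Subgroup ↥B.fullGroup :=
  B.levelIn n ⊓ B.Gcirc A

end BratteliDiagram

/-- Conjugation of a subgroup: `g • H = gHg⁻¹`. -/
def conjSub {Γ : Type*} [Group Γ] (g : Γ) (H : Subgroup Γ) : Subgroup Γ :=
  Subgroup.map (MulAut.conj g).toMonoidHom H

/-- The Borel structure on the space `Sub(Γ)` of subgroups of `Γ`,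
induced from the product space `{0,1}^Γ` (equivalently `Set Γ`). -/
instance subgroupMeasurableSpace {Γ : Type*} [Group Γ] : MeasurableSpace (Subgroup Γ) :=
  MeasurableSpace.comap (fun H => (H : Set Γ)) inferInstance

namespace BratteliDiagram

variable (B : BratteliDiagram)

/-- `F(A)`: the collection of subgroups of the full group normalized by `G°(A)`. -/
def FF (A : Set B.Path) : Set (Subgroup ↥B.fullGroup) :=
  { H | ∀ g ∈ B.Gcirc A, conjSub g H = H }

end BratteliDiagram

/-- A measure `ν` on `Y` is invariant under the action of `G`. -/
def MeasInv (G : Type*) [Group G] {Y : Type*} [MeasurableSpace Y] [MulAction G Y]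
    (ν : Measure Y) : Prop :=
  ∀ (g : G) (s : Set Y), MeasurableSet s → ν ((fun y => g • y) ⁻¹' s) = ν s

/-- The action of `G` on `(Y, ν)` is ergodic: every invariant measurable set is null or conull. -/
def MeasErg (G : Type*) [Group G] {Y : Type*} [MeasurableSpace Y] [MulAction G Y]
    (ν : Measure Y) : Prop :=
  ∀ s : Set Y, MeasurableSet s → (∀ g : G, (fun y => g • y) ⁻¹' s = s) → ν s = 0 ∨ ν s = 1

/-- An invariant random subgroup: a conjugation-invariant Borel probability measure on `Sub(G)`. -/
def IsIRS (G : Type*) [Group G] (φ : Measure (Subgroup G)) : Prop :=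
  IsProbabilityMeasure φ ∧
    ∀ (g : G) (s : Set (Subgroup G)), MeasurableSet s → φ (conjSub g ⁻¹' s) = φ s

/-- An ergodic invariant random subgroup. -/
def IsErgodicIRS (G : Type*) [Group G] (φ : Measure (Subgroup G)) : Prop :=
  IsIRS G φ ∧
    ∀ s : Set (Subgroup G), MeasurableSet s → (∀ g : G, conjSub g ⁻¹' s = s) →
      φ s = 0 ∨ φ s = 1

/-- A character of a group: normalized, central, positive semidefinite complex function. -/
def IsCharacter (G : Type*) [Group G] (χ : G → ℂ) : Prop :=
  χ 1 = 1 ∧ (∀ a b : G, χ (a * b) = χ (b * a)) ∧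
    ∀ (n : ℕ) (g : Fin n → G) (c : Fin n → ℂ),
      0 ≤ ∑ i, ∑ j, (starRingEnd ℂ) (c i) * c j * χ (g i * (g j)⁻¹)

namespace BratteliDiagram

variable (B : BratteliDiagram)

/-- The product measure `μ_α = μ_1^{α_1} × ⋯ × μ_k^{α_k}` on `X^{|α|}`,
realized on the index type `Σ i : Fin k, Fin (α i)` (of cardinality `|α| = Σ α i`). -/
def prodMeasure {k : ℕ} (μ : Fin k → Measure B.Path) (α : Fin k → ℕ) :
    Measure ((Σ i : Fin k, Fin (α i)) → B.Path) :=
  Measure.pi fun p => μ p.1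

/-- The stabilizer distribution `φ_α` of the diagonal action of the full group
on `(X^{|α|}, μ_α)`. -/
def stabDist {k : ℕ} (μ : Fin k → Measure B.Path) (α : Fin k → ℕ) :
    Measure (Subgroup ↥B.fullGroup) :=
  Measure.map (fun y => MulAction.stabilizer ↥B.fullGroup y) (B.prodMeasure μ α)

end BratteliDiagram

namespace BratteliDiagram
variable (B : BratteliDiagram)

/-- an even finite type carries a free involution together with a `Bool`-valued equivariant map -/
theorem exists_free_involution (α : Type) [Finite α] (h : Even (Nat.card α)) :
    ∃ (t : α → α) (e : α → Bool), (∀ a, t (t a) = a) ∧ ∀ a, e (t a) = !e a := by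
  obtain ⟨r, hr⟩ := h
  have this_card : Nat.card α = Nat.card (Fin r × Bool) := by
    rw [hr]; simp [Nat.card_eq_fintype_card]; omega
  have e : α ≃ Fin r × Bool := by
    have := Fintype.ofFinite α
    exact Fintype.equivOfCardEq (by rw [← Nat.card_eq_fintype_card, ← Nat.card_eq_fintype_card, this_card])
  refine ⟨fun a => e.symm ((e a).1, !(e a).2), fun a => (e a).2, fun a => ?_, fun a => ?_⟩
  · simp
  · simp

/-- the window of a path -/
def seg (n L : ℕ) (x : B.Path) : B.Seg n L :=
  ⟨fun i => x.1 (n + i), fun i _ => x.2 (n + i)⟩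

/-- replace the window of a sequence -/
def repl (n L : ℕ) (x : ∀ i, B.E i) (f : B.Seg n L) : ∀ i, B.E i := fun i =>
  if h : n ≤ i ∧ i ≤ n + L then
    (show n + (i - n) = i by omega) ▸ f.1 ⟨i - n, by omega⟩ else x i

theorem repl_out {n L : ℕ} (x : ∀ i, B.E i) (f : B.Seg n L) {i : ℕ} (h : i < n ∨ n + L < i) :
    B.repl n L x f i = x i := by
  unfold repl
  rw [dif_neg (by omega)]

theorem repl_in {n L : ℕ} (x : ∀ i, B.E i) (f : B.Seg n L) (j : ℕ) (h : j ≤ L) :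
    B.repl n L x f (n + j) = f.1 ⟨j, by omega⟩ := by
  unfold repl
  rw [dif_pos (by omega)]
  have key : ∀ (a : ℕ) (ha : a < L + 1) (e : n + a = n + j), e ▸ f.1 ⟨a, ha⟩ = f.1 ⟨j, by omega⟩ := by
    intro a ha e
    obtain rfl : a = j := by omega
    rfl
  exact key _ _ _

/-- replacing window of a path by one with the same endpoints -/
def replPath (n L : ℕ) (x : B.Path) (f : B.Seg n L)
    (h0 : B.src n (f.1 ⟨0, by omega⟩) = B.src n (x.1 n))
    (h1 : B.rng (n + L) (f.1 ⟨L, by omega⟩) = B.rng (n + L) (x.1 (n + L))) : B.Path :=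
  ⟨B.repl n L x.1 f, by
    intro i
    rcases lt_or_ge (i + 1) n with h | h
    · rw [B.repl_out _ _ (by omega), B.repl_out _ _ (by omega)]; exact x.2 i
    rcases eq_or_lt_of_le h with h | h
    · subst h
      rw [B.repl_out _ _ (by omega), x.2 i, ← h0]
      have := B.repl_in x.1 f 0 (by omega)
      rw [← this]
      try rfl
    rcases lt_or_ge i (n + L) with h' | h'
    · obtain ⟨j, rfl⟩ := Nat.exists_eq_add_of_le (show n ≤ i by omega)
      have h2 := B.repl_in x.1 f j (by omega)
      have h3 := B.repl_in x.1 f (j + 1) (by omega)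
      rw [h2]
      refine (f.2 j (by omega)).trans ?_
      rw [← h3]; rfl
    rcases eq_or_lt_of_le h' with h' | h'
    · subst h'
      rw [B.repl_in x.1 f L le_rfl, h1, B.repl_out _ _ (by omega)]; exact x.2 _
    · rw [B.repl_out _ _ (by omega), B.repl_out _ _ (by omega)]; exact x.2 i⟩

instance (n L : ℕ) : Finite (B.Seg n L) := by
  have := B.fintypeE
  unfold Seg
  infer_instance

theorem exists_tau (heven : B.IsEven) (n : ℕ) : ∃ (m : ℕ) (τ : B.Path → B.Path) (ε : B.Path → Bool),
    n < m ∧ (∀ x, τ (τ x) = x) ∧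
    (∀ x i, (i < n ∨ m ≤ i) → (τ x).1 i = x.1 i) ∧
    (∀ x y, (∀ i, n ≤ i → i < m → x.1 i = y.1 i) → ∀ i, n ≤ i → i < m → (τ x).1 i = (τ y).1 i) ∧
    (∀ x, ε (τ x) = !ε x) ∧
    (∀ x y, (∀ i, n ≤ i → i < m → x.1 i = y.1 i) → ε x = ε y) := by
  obtain ⟨L, hL⟩ := heven n
  have H : ∀ (v : B.V n) (w : B.V (n + L + 1)), ∃ (t : { f : B.Seg n L //
      B.src n (f.1 ⟨0, by omega⟩) = v ∧ B.rng (n + L) (f.1 ⟨L, by omega⟩) = w } → { f : B.Seg n L //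
      B.src n (f.1 ⟨0, by omega⟩) = v ∧ B.rng (n + L) (f.1 ⟨L, by omega⟩) = w })
      (e : { f : B.Seg n L //
      B.src n (f.1 ⟨0, by omega⟩) = v ∧ B.rng (n + L) (f.1 ⟨L, by omega⟩) = w } → Bool),
      (∀ a, t (t a) = a) ∧ ∀ a, e (t a) = !e a := fun v w =>
    exists_free_involution _ (hL v w).2
  choose t e ht he using H
  let T : B.Seg n L → B.Seg n L := fun f => (t _ _ ⟨f, rfl, rfl⟩).1
  let e' : B.Seg n L → Bool := fun f => e _ _ ⟨f, rfl, rfl⟩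
  have key : ∀ v w (f : B.Seg n L) (h : B.src n (f.1 ⟨0, by omega⟩) = v ∧
      B.rng (n + L) (f.1 ⟨L, by omega⟩) = w), T f = (t v w ⟨f, h⟩).1 ∧ e' f = e v w ⟨f, h⟩ := by
    rintro v w f ⟨rfl, rfl⟩
    exact ⟨rfl, rfl⟩
  have hT1 : ∀ f, B.src n ((T f).1 ⟨0, by omega⟩) = B.src n (f.1 ⟨0, by omega⟩) := fun f =>
    (t _ _ ⟨f, rfl, rfl⟩).2.1
  have hT2 : ∀ f, B.rng (n + L) ((T f).1 ⟨L, by omega⟩) = B.rng (n + L) (f.1 ⟨L, by omega⟩) :=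
    fun f => (t _ _ ⟨f, rfl, rfl⟩).2.2
  have hTT : ∀ f, T (T f) = f := by
    intro f
    rw [(key _ _ (T f) ⟨hT1 f, hT2 f⟩).1]
    have := ht _ _ ⟨f, rfl, rfl⟩
    exact congrArg Subtype.val this
  have hTe : ∀ f, e' (T f) = !e' f := by
    intro f
    rw [(key _ _ (T f) ⟨hT1 f, hT2 f⟩).2]
    exact he _ _ ⟨f, rfl, rfl⟩
  let τ : B.Path → B.Path := fun x => B.replPath n L x (T (B.seg n L x)) (hT1 _) (hT2 _)
  have hseg : ∀ x, B.seg n L (τ x) = T (B.seg n L x) := by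
    intro x
    apply Subtype.ext
    funext i
    exact B.repl_in _ _ i (by omega)
  have hout : ∀ x i, (i < n ∨ n + L + 1 ≤ i) → (τ x).1 i = x.1 i := fun x i hi =>
    B.repl_out _ _ (by omega)
  have hin : ∀ x (j : ℕ) (hj : j ≤ L), (τ x).1 (n + j) = (T (B.seg n L x)).1 ⟨j, by omega⟩ :=
    fun x j hj => B.repl_in _ _ j hj
  have hsegc : ∀ x y : B.Path, (∀ i, n ≤ i → i < n + L + 1 → x.1 i = y.1 i) →
      B.seg n L x = B.seg n L y := by
    intro x y h
    apply Subtype.ext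
    funext i
    exact h _ (by omega) (by omega)
  refine ⟨n + L + 1, τ, fun x => e' (B.seg n L x), by omega, ?_, hout, ?_, ?_, ?_⟩
  · intro x
    apply Subtype.ext
    funext i
    by_cases hi : i < n ∨ n + L + 1 ≤ i
    · rw [hout _ _ hi, hout _ _ hi]
    · obtain ⟨j, rfl⟩ := Nat.exists_eq_add_of_le (show n ≤ i by omega)
      rw [hin _ _ (by omega), hseg, hTT]; rfl
  · intro x y h i h1 h2
    obtain ⟨j, rfl⟩ := Nat.exists_eq_add_of_le h1
    rw [hin _ _ (by omega), hin _ _ (by omega), hsegc x y h]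
  · intro x
    simp only [hseg, hTe]
  · intro x y h
    simp only [hsegc x y h]

end BratteliDiagram

namespace BratteliDiagram

/-- a sequence of consecutive windows with free involutions in each of them -/
structure Windows (B : BratteliDiagram) where
  k : ℕ → ℕ
  t : ℕ → B.Path → B.Path
  e : ℕ → B.Path → Bool
  k_lt : ∀ j, k j < k (j + 1)
  tt : ∀ j x, t j (t j x) = x
  out : ∀ j x i, (i < k j ∨ k (j + 1) ≤ i) → (t j x).1 i = x.1 i
  inn : ∀ j x y, (∀ i, k j ≤ i → i < k (j + 1) → x.1 i = y.1 i) →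
    ∀ i, k j ≤ i → i < k (j + 1) → (t j x).1 i = (t j y).1 i
  et : ∀ j x, e j (t j x) = !e j x
  e_congr : ∀ j x y, (∀ i, k j ≤ i → i < k (j + 1) → x.1 i = y.1 i) → e j x = e j y

theorem exists_windows (B : BratteliDiagram) (heven : B.IsEven) : Nonempty (Windows B) := by
  choose m τ ε h1 h2 h3 h4 h5 h6 using B.exists_tau heven
  let k : ℕ → ℕ := fun j => Nat.rec 0 (fun _ a => m a) j
  exact ⟨⟨k, fun j => τ (k j), fun j => ε (k j), fun j => h1 _, fun j => h2 _, fun j => h3 _,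
    fun j => h4 _, fun j => h5 _, fun j => h6 _⟩⟩

variable {B : BratteliDiagram}

/-- cylinder sets of level `n` -/
def Cyl (n : ℕ) (A : Set B.Path) : Prop :=
  ∀ x y : B.Path, (∀ i, i < n → x.1 i = y.1 i) → x ∈ A → y ∈ A

theorem Cyl.mono {n m : ℕ} (h : n ≤ m) {A : Set B.Path} (hA : Cyl n A) : Cyl m A :=
  fun x y hxy hx => hA x y (fun i hi => hxy i (by omega)) hx

theorem Cyl.iff {n : ℕ} {A : Set B.Path} (hA : Cyl n A) {x y : B.Path}
    (h : ∀ i, i < n → x.1 i = y.1 i) : x ∈ A ↔ y ∈ A :=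
  ⟨hA x y h, hA y x fun i hi => (h i hi).symm⟩

theorem Cyl.inter {n : ℕ} {A C : Set B.Path} (hA : Cyl n A) (hC : Cyl n C) : Cyl n (A ∩ C) :=
  fun x y h hx => ⟨hA x y h hx.1, hC x y h hx.2⟩

/-- fixed point set -/
def fx (g : ↥B.fullGroup) : Set B.Path := {x | g • x = x}

theorem path_ext {x y : B.Path} (h : ∀ i, x.1 i = y.1 i) : x = y := Subtype.ext (funext h)

theorem smul_tail {n : ℕ} {g : ↥B.fullGroup} (hg : g ∈ B.levelIn n) (x : B.Path) {i : ℕ}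
    (hi : n ≤ i) : (g • x).1 i = x.1 i := hg.1.1 x i hi

theorem smul_congr {n : ℕ} {g : ↥B.fullGroup} (hg : g ∈ B.levelIn n) {x y : B.Path}
    (h : ∀ i, i < n → x.1 i = y.1 i) (i : ℕ) (hi : i < n) : (g • x).1 i = (g • y).1 i :=
  hg.1.2 x y h i hi

theorem levelIn_mono {n m : ℕ} (h : n ≤ m) : B.levelIn n ≤ B.levelIn m :=
  fun _ hg => B.level_mono h hg

theorem exists_levelIn (g : ↥B.fullGroup) : ∃ n, g ∈ B.levelIn n := g.2

theorem cyl_fx {n : ℕ} {g : ↥B.fullGroup} (hg : g ∈ B.levelIn n) : Cyl n (fx g) := by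
  intro x y h hx
  apply path_ext
  intro i
  rcases lt_or_ge i n with hi | hi
  · rw [← smul_congr hg h i hi, ← h i hi]
    exact congrArg (fun z : B.Path => z.1 i) hx
  · exact smul_tail hg y hi

theorem group_ext {g h : ↥B.fullGroup} (H : ∀ x : B.Path, g • x = h • x) : g = h :=
  Subtype.ext (Equiv.ext H)

/-- build an element of the full group out of an involution of finite level -/
def mkInv (F : B.Path → B.Path) (hF : ∀ x, F (F x) = x) (n : ℕ)
    (h1 : ∀ x i, n ≤ i → (F x).1 i = x.1 i)
    (h2 : ∀ x y : B.Path, (∀ i, i < n → x.1 i = y.1 i) → ∀ i, i < n → (F x).1 i = (F y).1 i) :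
    ↥B.fullGroup :=
  ⟨⟨F, F, hF, hF⟩, n, ⟨h1, h2⟩, ⟨h1, h2⟩⟩

theorem mkInv_smul (F : B.Path → B.Path) (hF n h1 h2) (x : B.Path) :
    mkInv F hF n h1 h2 • x = F x := rfl

theorem mkInv_level (F : B.Path → B.Path) (hF n h1 h2) :
    mkInv F hF n h1 h2 ∈ B.levelIn n := ⟨⟨h1, h2⟩, ⟨h1, h2⟩⟩

theorem mkInv_sq (F : B.Path → B.Path) (hF n h1 h2) :
    mkInv F hF n h1 h2 * mkInv F hF n h1 h2 = 1 := by
  apply group_ext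
  intro x
  rw [mul_smul, mkInv_smul, mkInv_smul, hF, one_smul]

namespace Windows
variable (W : Windows B)

theorem k_mono {i j : ℕ} (h : i ≤ j) : W.k i ≤ W.k j :=
  (strictMono_nat_of_lt_succ W.k_lt).monotone h

theorem le_k (j : ℕ) : j ≤ W.k j := (strictMono_nat_of_lt_succ W.k_lt).id_le j

theorem t_lt {j i : ℕ} (x : B.Path) (h : i < j) : (W.t j x).1 i = x.1 i :=
  W.out j x i (Or.inl (h.trans_le (W.le_k j)))

theorem t_cyl {n j : ℕ} (h : n ≤ j) {A : Set B.Path} (hA : Cyl n A) (x : B.Path) :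
    W.t j x ∈ A ↔ x ∈ A := hA.iff fun _ hi => W.t_lt x (by omega)

theorem e_t_ne {i j : ℕ} (h : i ≠ j) (x : B.Path) : W.e i (W.t j x) = W.e i x := by
  apply W.e_congr
  intro l h1 h2
  apply W.out
  rcases lt_or_gt_of_ne h with h | h
  · have := W.k_mono (show i + 1 ≤ j by omega); omega
  · have := W.k_mono (show j + 1 ≤ i by omega); omega

theorem t_comm (i j : ℕ) (x : B.Path) : W.t i (W.t j x) = W.t j (W.t i x) := by
  rcases eq_or_ne i j with rfl | h
  · rfl
  wlog hij : i < j generalizing i j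
  · exact (this j i h.symm (by omega)).symm
  have hk := W.k_mono (show i + 1 ≤ j by omega)
  have := W.k_lt i
  have := W.k_lt j
  apply path_ext
  intro l
  by_cases h1 : W.k i ≤ l ∧ l < W.k (i + 1)
  · rw [W.out j (W.t i x) l (by omega)]
    exact W.inn i _ _ (fun a ha hb => W.out j x a (by omega)) l h1.1 h1.2
  by_cases h2 : W.k j ≤ l ∧ l < W.k (j + 1)
  · rw [W.out i (W.t j x) l (by omega)]
    exact (W.inn j _ _ (fun a ha hb => W.out i x a (by omega)) l h2.1 h2.2).symm
  · rw [W.out i _ l (by omega), W.out j _ l (by omega), W.out j _ l (by omega),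
      W.out i _ l (by omega)]

theorem t_smul {n j : ℕ} (h : n ≤ j) {g : ↥B.fullGroup} (hg : g ∈ B.levelIn n) (x : B.Path) :
    W.t j (g • x) = g • W.t j x := by
  have hk := W.le_k j
  apply path_ext
  intro l
  rcases lt_or_ge l n with hl | hl
  · rw [W.t_lt _ (by omega)]
    exact smul_congr hg (fun i hi => (W.t_lt x (by omega)).symm) l hl
  · rw [smul_tail hg _ hl]
    by_cases h1 : W.k j ≤ l ∧ l < W.k (j + 1)
    · exact W.inn j _ _ (fun a ha hb => smul_tail hg x (by omega)) l h1.1 h1.2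
    · rw [W.out j _ l (by omega), W.out j _ l (by omega), smul_tail hg _ hl]

theorem t_congr {m j : ℕ} (h : W.k (j + 1) ≤ m) {x y : B.Path} (hxy : ∀ i, i < m → x.1 i = y.1 i)
    (i : ℕ) (hi : i < m) : (W.t j x).1 i = (W.t j y).1 i := by
  by_cases h1 : W.k j ≤ i ∧ i < W.k (j + 1)
  · exact W.inn j _ _ (fun a ha hb => hxy a (by omega)) i h1.1 h1.2
  · rw [W.out j _ i (by omega), W.out j _ i (by omega), hxy i hi]

theorem e_smul {n j : ℕ} (h : n ≤ j) {g : ↥B.fullGroup} (hg : g ∈ B.levelIn n) (x : B.Path) :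
    W.e j (g • x) = W.e j x := by
  have hk := W.le_k j
  exact W.e_congr _ _ _ fun a ha hb => smul_tail hg x (by omega)

open Classical in
/-- apply the involution of a window chosen by `φ`, off `A` -/
def S (W : Windows B) (A : Set B.Path) (φ : B.Path → ℕ) (x : B.Path) : B.Path :=
  if x ∈ A then x else W.t (φ x) x

theorem S_S {n : ℕ} {A : Set B.Path} (hA : Cyl n A) {φ : B.Path → ℕ}
    (hφ : ∀ x y : B.Path, (∀ i, i < n → x.1 i = y.1 i) → φ x = φ y) (hn : ∀ x, n ≤ φ x)
    (x : B.Path) : W.S A φ (W.S A φ x) = x := by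
  unfold S
  by_cases h : x ∈ A
  · simp [h]
  · rw [if_neg h, if_neg (by rwa [W.t_cyl (hn x) hA])]
    have : φ (W.t (φ x) x) = φ x :=
      hφ _ _ fun i hi => W.t_lt _ (hi.trans_le (hn x))
    rw [this, W.tt]

open Classical in
/-- the corresponding group element (trivial unless the data are good) -/
def SG (W : Windows B) (A : Set B.Path) (φ : B.Path → ℕ) : ↥B.fullGroup :=
  if h : ∃ g : ↥B.fullGroup, (∀ x, g • x = W.S A φ x) then h.choose else 1

theorem SG_smul {n m : ℕ} {A : Set B.Path} (hA : Cyl n A) {φ : B.Path → ℕ}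
    (hφ : ∀ x y : B.Path, (∀ i, i < n → x.1 i = y.1 i) → φ x = φ y) (hn : ∀ x, n ≤ φ x)
    (hm : ∀ x, φ x ≤ m) (x : B.Path) : W.SG A φ • x = W.S A φ x := by
  have : ∃ g : ↥B.fullGroup, (∀ x, g • x = W.S A φ x) := by
    refine ⟨mkInv (W.S A φ) (W.S_S hA hφ hn) (W.k (m + 1)) ?_ ?_, fun x => rfl⟩
    · intro x i hi
      unfold S
      split_ifs
      · rfl
      · exact W.out _ _ _ (Or.inr ((W.k_mono (by have := hm x; omega)).trans hi))
    · intro x y hxy i hi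
      have hnk : n ≤ W.k (m + 1) := by
        have := hn x; have := hm x; have := W.le_k (m + 1); omega
      have h1 : x ∈ A ↔ y ∈ A := hA.iff fun i hi => hxy i (by omega)
      have h2 : φ x = φ y := hφ x y fun i hi => hxy i (by omega)
      unfold S
      by_cases h : x ∈ A
      · rw [if_pos h, if_pos (h1.1 h)]; exact hxy i hi
      · rw [if_neg h, if_neg (fun hh => h (h1.2 hh)), h2]
        exact W.t_congr (W.k_mono (by have := hm y; omega)) hxy i hi
  unfold SG
  rw [dif_pos this]
  exact this.choose_spec x

/-- shift by the window `j` off the set `A` -/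
def T (W : Windows B) (A : Set B.Path) (j : ℕ) : ↥B.fullGroup := W.SG A (fun _ => j)

theorem T_mem {n j : ℕ} (h : n ≤ j) {A : Set B.Path} (hA : Cyl n A) {x : B.Path} (hx : x ∈ A) :
    W.T A j • x = x := by
  unfold T
  rw [W.SG_smul (m := j) hA (fun _ _ _ => rfl) (fun _ => h) (fun _ => le_rfl), S, if_pos hx]

theorem T_notMem {n j : ℕ} (h : n ≤ j) {A : Set B.Path} (hA : Cyl n A) {x : B.Path} (hx : x ∉ A) :
    W.T A j • x = W.t j x := by
  unfold T
  rw [W.SG_smul (m := j) hA (fun _ _ _ => rfl) (fun _ => h) (fun _ => le_rfl), S, if_neg hx]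

theorem T_sq {n j : ℕ} (h : n ≤ j) {A : Set B.Path} (hA : Cyl n A) : W.T A j * W.T A j = 1 := by
  apply group_ext
  intro x
  rw [mul_smul, one_smul]
  by_cases hx : x ∈ A
  · rw [W.T_mem h hA hx, W.T_mem h hA hx]
  · rw [W.T_notMem h hA hx, W.T_notMem h hA (by rwa [W.t_cyl h hA]), W.tt]

theorem t_ne (j : ℕ) (x : B.Path) : W.t j x ≠ x := by
  intro h
  have := W.et j x
  rw [h] at this
  simp at this

theorem fx_T {n j : ℕ} (h : n ≤ j) {A : Set B.Path} (hA : Cyl n A) : fx (W.T A j) = A := by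
  ext x
  constructor
  · intro hx
    by_contra hxA
    exact W.t_ne j x (by rw [← W.T_notMem h hA hxA]; exact hx)
  · exact W.T_mem h hA

theorem T_cyl {n j : ℕ} (h : n ≤ j) {A C : Set B.Path} (hA : Cyl n A) (hC : Cyl n C) (x : B.Path) :
    W.T A j • x ∈ C ↔ x ∈ C := by
  by_cases hx : x ∈ A
  · rw [W.T_mem h hA hx]
  · rw [W.T_notMem h hA hx, W.t_cyl h hC]

theorem e_T_ne {n i j : ℕ} (h : n ≤ j) {A : Set B.Path} (hA : Cyl n A) (hij : i ≠ j) (x : B.Path) :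
    W.e i (W.T A j • x) = W.e i x := by
  by_cases hx : x ∈ A
  · rw [W.T_mem h hA hx]
  · rw [W.T_notMem h hA hx, W.e_t_ne hij]

theorem T_comm {n i j : ℕ} (hi : n ≤ i) (hj : n ≤ j) {A C : Set B.Path} (hA : Cyl n A)
    (hC : Cyl n C) : W.T A i * W.T C j = W.T C j * W.T A i := by
  apply group_ext
  intro x
  rw [mul_smul, mul_smul]
  by_cases hx : x ∈ A <;> by_cases hy : x ∈ C
  · rw [W.T_mem hj hC hy, W.T_mem hi hA hx, W.T_mem hj hC hy]
  · rw [W.T_notMem hj hC hy, W.T_mem hi hA hx, W.T_notMem hj hC hy,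
      W.T_mem hi hA (by rwa [W.t_cyl hj hA])]
  · rw [W.T_mem hj hC hy, W.T_notMem hi hA hx, W.T_mem hj hC (by rwa [W.t_cyl hi hC])]
  · rw [W.T_notMem hj hC hy, W.T_notMem hi hA hx, W.T_notMem hj hC (by rwa [W.t_cyl hi hC]),
      W.T_notMem hi hA (by rwa [W.t_cyl hj hA]), W.t_comm]

theorem fx_T_T {n i j : ℕ} (hi : n ≤ i) (hj : n ≤ j) (hij : i ≠ j) {A C : Set B.Path}
    (hA : Cyl n A) (hC : Cyl n C) : fx (W.T A i * W.T C j) = A ∩ C := by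
  have key : ∀ {i j : ℕ} (_ : n ≤ i) (_ : n ≤ j) (_ : i ≠ j) {A C : Set B.Path}
    (_ : Cyl n A) (_ : Cyl n C) (x : B.Path), x ∉ A → (W.T A i * W.T C j) • x ≠ x := by
    intro i j hi hj hij A C hA hC x hx h
    rw [mul_smul, W.T_notMem hi hA (by rwa [W.T_cyl hj hC hA])] at h
    have := W.et i (W.T C j • x)
    rw [h, W.e_T_ne hj hC hij] at this
    simp at this
  ext x
  constructor
  · intro hx
    constructor
    · by_contra h
      exact key hi hj hij hA hC x h hx
    · by_contra h
      refine key hj hi hij.symm hC hA x h ?_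
      rw [← W.T_comm hi hj hA hC]; exact hx
  · rintro ⟨h1, h2⟩
    change (W.T A i * W.T C j) • x = x
    rw [mul_smul, W.T_mem hj hC h2, W.T_mem hi hA h1]

theorem smul_mem_iff {g : ↥B.fullGroup} {A : Set B.Path} (hA : A ⊆ fx g) (x : B.Path) :
    g • x ∈ A ↔ x ∈ A := by
  constructor
  · intro h
    have h2 : g • (g • x) = g • x := hA h
    have h3 : g • x = x := smul_left_cancel g h2
    rwa [h3] at h
  · intro h
    have h2 : g • x = x := hA h
    rwa [h2]

theorem T_smul_comm {n j : ℕ} (hj : n ≤ j) {g : ↥B.fullGroup} (hg : g ∈ B.levelIn n)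
    {A : Set B.Path} (hA : Cyl n A) (hAg : A ⊆ fx g) : g * W.T A j = W.T A j * g := by
  apply group_ext
  intro x
  rw [mul_smul, mul_smul]
  by_cases hx : x ∈ A
  · have : g • x = x := hAg hx
    rw [W.T_mem hj hA hx, this, W.T_mem hj hA hx]
  · rw [W.T_notMem hj hA hx, W.T_notMem hj hA (by rwa [smul_mem_iff hAg]), W.t_smul hj hg]

theorem fx_mul_T {n j : ℕ} (hj : n ≤ j) {g : ↥B.fullGroup} (hg : g ∈ B.levelIn n)
    {A : Set B.Path} (hA : Cyl n A) (hAg : A ⊆ fx g) : fx (g * W.T A j) = A := by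
  ext x
  constructor
  · intro hx
    by_contra h
    have hx : (g * W.T A j) • x = x := hx
    rw [mul_smul, W.T_notMem hj hA h] at hx
    have := W.et j x
    rw [← W.e_smul hj hg, hx] at this
    simp at this
  · intro h
    change (g * W.T A j) • x = x
    rw [mul_smul, W.T_mem hj hA h]
    exact hAg h

theorem fx_mul_T_T {n i j : ℕ} (hi : n ≤ i) (hj : n ≤ j) (hij : i ≠ j) {g : ↥B.fullGroup}
    (hg : g ∈ B.levelIn n) {A : Set B.Path} (hA : Cyl n A) (hAg : A ⊆ fx g) :
    fx (g * (W.T A i * W.T A j)) = A := by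
  ext x
  constructor
  · intro hx
    by_contra h
    have hx : (g * (W.T A i * W.T A j)) • x = x := hx
    rw [mul_smul, mul_smul, W.T_notMem hi hA (by rwa [W.T_cyl hj hA hA])] at hx
    have := W.et i (W.T A j • x)
    rw [← W.e_smul hi hg, hx, W.e_T_ne hj hA hij] at this
    simp at this
  · intro h
    change (g * (W.T A i * W.T A j)) • x = x
    rw [mul_smul, mul_smul, W.T_mem hj hA h, W.T_mem hi hA h]
    exact hAg h

end Windows
end BratteliDiagram

namespace BratteliDiagram
variable {B : BratteliDiagram}

/-- the prefix of a path -/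
def pre (n : ℕ) (x : B.Path) : ∀ i : Fin n, B.E i := fun i => x.1 i

instance instFinitePre (n : ℕ) : Finite (∀ i : Fin n, B.E i) := by
  have : ∀ i : Fin n, Finite (B.E i) := fun i => @Finite.of_fintype _ (B.fintypeE i)
  infer_instance

theorem pre_eq {n : ℕ} {x y : B.Path} : pre n x = pre n y ↔ ∀ i, i < n → x.1 i = y.1 i :=
  ⟨fun h i hi => congrFun h ⟨i, hi⟩, fun h => funext fun i => h i i.2⟩

/-- numerical encoding of the prefix -/
def enc (n : ℕ) (x : B.Path) : ℕ := (Finite.equivFin (∀ i : Fin n, B.E i) (pre n x) : ℕ)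

theorem enc_eq {n : ℕ} {x y : B.Path} : enc n x = enc n y ↔ ∀ i, i < n → x.1 i = y.1 i := by
  rw [← pre_eq]
  unfold enc
  rw [Fin.val_inj, EmbeddingLike.apply_eq_iff_eq]

/-- number of prefixes -/
def encq (B : BratteliDiagram) (n : ℕ) : ℕ := Nat.card (∀ i : Fin n, B.E i)

theorem enc_lt (n : ℕ) (x : B.Path) : enc n x < encq B n := Fin.is_lt _

theorem eq_of_enc {n : ℕ} {g : ↥B.fullGroup} (hg : g ∈ B.levelIn n) {x : B.Path}
    (h : enc n (g • x) = enc n x) : g • x = x := by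
  apply path_ext
  intro i
  rcases lt_or_ge i n with hi | hi
  · exact enc_eq.1 h i hi
  · exact smul_tail hg x hi

theorem theta_lemma {s t : ↥B.fullGroup} (hs : s * s = 1) (ht : t * t = 1) (hst : s * t = t * s)
    {A : Set B.Path} (hAs : A ⊆ fx s) (hAt : A ⊆ fx t) (ε : B.Path → Bool) (m : ℕ)
    (htm : t ∈ B.levelIn m)
    (hε : ∀ x y : B.Path, (∀ i, i < m → x.1 i = y.1 i) → ε x = ε y)
    (h1 : ∀ x, ε (t • x) = ε x) (h2 : ∀ x, x ∉ A → ε (s • x) = !ε x) :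
    ∃ θ : ↥B.fullGroup, A ⊆ fx θ ∧ θ * s * θ⁻¹ = s * t := by
  have htt : ∀ x : B.Path, t • t • x = x := fun x => by rw [← mul_smul, ht, one_smul]
  have hst' : ∀ x : B.Path, s • t • x = t • s • x := fun x => by rw [← mul_smul, hst, mul_smul]
  let F : B.Path → B.Path := fun x => if ε x then t • x else x
  have hFF : ∀ x, F (F x) = x := by
    intro x
    by_cases h : ε x = true
    · simp only [F, h, if_true, h1, htt]
    · simp only [F, h, if_false, Bool.false_eq_true]
  let θ := mkInv F hFF m (by
      intro x i hi
      simp only [F]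
      split_ifs
      · exact smul_tail htm x hi
      · rfl) (by
      intro x y hxy i hi
      simp only [F, hε x y hxy]
      split_ifs
      · exact smul_congr htm hxy i hi
      · exact hxy i hi)
  have hθ : ∀ x, θ • x = F x := fun x => rfl
  have hθ2 : θ⁻¹ = θ := by
    rw [inv_eq_iff_mul_eq_one]; exact mkInv_sq ..
  refine ⟨θ, ?_, ?_⟩
  · intro x hx
    have : t • x = x := hAt hx
    change θ • x = x
    rw [hθ]; simp only [F, this, ite_self]
  · rw [hθ2]
    apply group_ext
    intro x
    rw [mul_smul, mul_smul, mul_smul, hθ, hθ]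
    by_cases hx : x ∈ A
    · have e1 : t • x = x := hAt hx
      have e2 : s • x = x := hAs hx
      simp only [F, e1, ite_self, e2]
    · by_cases h : ε x = true
      · simp only [F, h, if_true]
        rw [hst', h1, h2 x hx, h]; simp
      · simp only [F, h, if_false, Bool.false_eq_true, h2 x hx]
        simp [h, hst']

namespace Windows
variable (W : Windows B)

theorem T_level {n j m : ℕ} (h : n ≤ j) {A : Set B.Path} (hA : Cyl n A) (hm : W.k (j + 1) ≤ m) :
    W.T A j ∈ B.levelIn m := by
  have key : B.IsLevel m (W.T A j : Equiv.Perm B.Path) := by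
    constructor
    · intro x i hi
      change (W.T A j • x).1 i = _
      by_cases hx : x ∈ A
      · rw [W.T_mem h hA hx]
      · rw [W.T_notMem h hA hx]
        exact W.out _ _ _ (Or.inr (hm.trans hi))
    · intro x y hxy i hi
      change (W.T A j • x).1 i = (W.T A j • y).1 i
      have hnm : n ≤ m := by have := W.le_k (j + 1); omega
      have h1 : x ∈ A ↔ y ∈ A := hA.iff fun i hi => hxy i (by omega)
      by_cases hx : x ∈ A
      · rw [W.T_mem h hA hx, W.T_mem h hA (h1.1 hx)]; exact hxy i hi
      · rw [W.T_notMem h hA hx, W.T_notMem h hA (fun hh => hx (h1.2 hh))]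
        exact W.t_congr hm hxy i hi
  refine ⟨key, ?_⟩
  have : (W.T A j)⁻¹ = W.T A j := by
    rw [inv_eq_iff_mul_eq_one]; exact W.T_sq h hA
  change B.IsLevel m (((W.T A j)⁻¹ : ↥B.fullGroup) : Equiv.Perm B.Path)
  rw [this]; exact key

theorem T_pre {n j : ℕ} (h : n ≤ j) {A : Set B.Path} (hA : Cyl n A) (x : B.Path) {i : ℕ}
    (hi : i < n) : (W.T A j • x).1 i = x.1 i := by
  by_cases hx : x ∈ A
  · rw [W.T_mem h hA hx]
  · rw [W.T_notMem h hA hx]; exact W.t_lt x (by omega)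

theorem enc_T {n j : ℕ} (h : n ≤ j) {A : Set B.Path} (hA : Cyl n A) (x : B.Path) :
    enc n (W.T A j • x) = enc n x := enc_eq.2 fun _ hi => W.T_pre h hA x hi

theorem conj_T {n j : ℕ} {s : ↥B.fullGroup} (hs : s * s = 1) (hsn : s ∈ B.levelIn n)
    (hj : n ≤ j) : ∃ θ : ↥B.fullGroup, fx s ⊆ fx θ ∧ θ * s * θ⁻¹ = W.T (fx s) j := by
  have hA := cyl_fx hsn
  set A := fx s with hAdef
  have hss : ∀ x : B.Path, s • s • x = x := fun x => by rw [← mul_smul, hs, one_smul]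
  have hc := W.T_smul_comm hj hsn hA hAdef.subset
  have hkj := W.le_k (j + 1)
  obtain ⟨θ1, a1, b1⟩ := theta_lemma (A := A) hs (W.T_sq hj hA) hc hAdef.subset
    (W.fx_T hj hA).symm.subset (fun x => decide (enc n (s • x) < enc n x)) (W.k (j + 1))
    (W.T_level hj hA le_rfl) (by
      intro x y hxy
      have e1 : enc n x = enc n y := enc_eq.2 fun i hi => hxy i (by omega)
      have e2 : enc n (s • x) = enc n (s • y) := enc_eq.2 fun i hi =>
        smul_congr hsn (fun i hi => hxy i (by omega)) i hi
      simp only [e1, e2]) (by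
      intro x
      have : s • W.T A j • x = W.T A j • s • x := by rw [← mul_smul, hc, mul_smul]
      simp only [this, W.enc_T hj hA]) (by
      intro x hx
      have : enc n (s • x) ≠ enc n x := fun h => hx (eq_of_enc hsn h)
      simp only [hss]
      rcases lt_or_gt_of_ne this with h | h
      · simp [h, h.le]
      · simp [h, h.le])
  obtain ⟨θ2, a2, b2⟩ := theta_lemma (A := A) (W.T_sq hj hA) hs hc.symm
    (W.fx_T hj hA).symm.subset hAdef.subset (W.e j) (W.k (j + 1))
    (levelIn_mono (by omega) hsn) (by
      intro x y hxy
      exact W.e_congr _ _ _ fun i _ hi => hxy i hi) (by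
      intro x
      exact W.e_smul hj hsn x) (by
      intro x hx
      rw [W.T_notMem hj hA hx, W.et])
  refine ⟨θ2⁻¹ * θ1, ?_, ?_⟩
  · intro x hx
    have e1 : θ1 • x = x := a1 hx
    have e2 : θ2 • x = x := a2 hx
    change (θ2⁻¹ * θ1) • x = x
    rw [mul_smul, e1, inv_smul_eq_iff, e2]
  · have : θ2⁻¹ * θ1 * s * (θ2⁻¹ * θ1)⁻¹ = θ2⁻¹ * (θ1 * s * θ1⁻¹) * θ2 := by group
    rw [this, b1, hc, ← b2]; group

/-- involutions with the same fixed points are conjugate, fixing these points -/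
theorem conj_inv (W : Windows B) {s t : ↥B.fullGroup} (hs : s * s = 1) (ht : t * t = 1) (h : fx s = fx t) :
    ∃ θ : ↥B.fullGroup, fx s ⊆ fx θ ∧ θ * s * θ⁻¹ = t := by
  obtain ⟨n, hn⟩ := exists_levelIn s
  obtain ⟨m, hm⟩ := exists_levelIn t
  obtain ⟨θ1, a1, b1⟩ := W.conj_T hs hn (le_max_left n m)
  obtain ⟨θ2, a2, b2⟩ := W.conj_T ht hm (le_max_right n m)
  rw [← h] at a2 b2
  refine ⟨θ2⁻¹ * θ1, ?_, ?_⟩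
  · intro x hx
    have e1 : θ1 • x = x := a1 hx
    have e2 : θ2 • x = x := a2 hx
    change (θ2⁻¹ * θ1) • x = x
    rw [mul_smul, e1, inv_smul_eq_iff, e2]
  · have : θ2⁻¹ * θ1 * s * (θ2⁻¹ * θ1)⁻¹ = θ2⁻¹ * (θ1 * s * θ1⁻¹) * θ2 := by group
    rw [this, b1, ← b2]; group

/-- conjugates of `γ` whose quotients are involutions -/
theorem exists_seq (W : Windows B) (γ : ↥B.fullGroup) :
    ∃ g : ℕ → ↥B.fullGroup, (∀ i, ∃ θ, g i = θ * γ * θ⁻¹) ∧ (∀ i, fx γ ⊆ fx (g i)) ∧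
      ∀ i j, i ≠ j → (g i * (g j)⁻¹) * (g i * (g j)⁻¹) = 1 ∧ fx (g i * (g j)⁻¹) = fx γ := by
  obtain ⟨n, hn⟩ := exists_levelIn γ
  let φ : ℕ → B.Path → ℕ := fun i x => n + i * encq B n + enc n x
  have hφ : ∀ i (x y : B.Path), (∀ i, i < n → x.1 i = y.1 i) → φ i x = φ i y := by
    intro i x y h
    simp only [φ, enc_eq.2 h]
  have hφn : ∀ i x, n ≤ φ i x := fun i x => by simp only [φ]; omega
  have hemp : Cyl n (∅ : Set B.Path) := fun x y _ h => h.elim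
  let S : ℕ → ↥B.fullGroup := fun i => W.SG ∅ (φ i)
  have hS : ∀ i x, S i • x = W.t (φ i x) x := by
    intro i x
    have := W.SG_smul (m := n + i * encq B n + encq B n) hemp (hφ i) (hφn i) (fun x => by
      have := enc_lt n x; simp only [φ]; omega) x
    simp only [S, this, Windows.S, Set.mem_empty_iff_false, if_false]
  have hφt : ∀ i a x, n ≤ a → φ i (W.t a x) = φ i x := fun i a x h =>
    hφ i _ _ fun l hl => W.t_lt x (by omega)
  have hSS : ∀ i, S i * S i = 1 := by
    intro i; apply group_ext; intro x
    rw [mul_smul, hS, hS, hφt _ _ _ (hφn i x), W.tt, one_smul]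
  have hSi : ∀ i, (S i)⁻¹ = S i := fun i => by rw [inv_eq_iff_mul_eq_one]; exact hSS i
  let D : ℕ → ↥B.fullGroup := fun i => S i * γ * S i * γ⁻¹
  have hni : γ⁻¹ ∈ B.levelIn n := inv_mem hn
  have hD : ∀ i x, D i • x = W.t (φ i x) (W.t (φ i (γ⁻¹ • x)) x) := by
    intro i x
    simp only [D, mul_smul]
    rw [hS i (γ⁻¹ • x), ← W.t_smul (hφn i _) hn, smul_inv_smul, hS, hφt _ _ _ (hφn i _)]
  have hφγ : ∀ i a x, n ≤ a → φ i (γ⁻¹ • W.t a x) = φ i (γ⁻¹ • x) := fun i a x h => by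
    rw [← W.t_smul h hni, hφt _ _ _ h]
  have hDc : ∀ i j, D i * D j = D j * D i := by
    intro i j
    apply group_ext
    intro x
    simp only [mul_smul, hD, hφt _ _ _ (hφn _ _), hφγ _ _ _ (hφn _ _)]
    generalize φ i x = a
    generalize φ i (γ⁻¹ • x) = b
    generalize φ j x = c
    generalize φ j (γ⁻¹ • x) = d
    rw [W.t_comm b c (W.t d x), W.t_comm b d x, W.t_comm a c _, W.t_comm a d (W.t b x)]
  have hD1 : ∀ i, D i * D i = 1 := by
    intro i
    apply group_ext
    intro x
    simp only [mul_smul, hD, hφt _ _ _ (hφn _ _), hφγ _ _ _ (hφn _ _), one_smul]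
    rw [W.t_comm (φ i x) (φ i (γ⁻¹ • x)) x, W.tt, W.tt]
  have hDD : ∀ i j, D i * D j * (D i * D j) = 1 := by
    intro i j
    calc D i * D j * (D i * D j) = D i * D j * (D j * D i) := by rw [hDc i j]
      _ = D i * (D j * D j) * D i := by group
      _ = 1 := by rw [hD1, mul_one, hD1]
  have hDi : ∀ i, (D i)⁻¹ = D i := fun i => by rw [inv_eq_iff_mul_eq_one]; exact hD1 i
  let g : ℕ → ↥B.fullGroup := fun i => S i * γ * S i
  have hg : ∀ i, g i = D i * γ := fun i => by simp only [g, D]; group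
  have hgg : ∀ i j, g i * (g j)⁻¹ = D i * D j := by
    intro i j
    rw [hg, hg, mul_inv_rev, hDi]; group
  have hfixi : ∀ x, x ∈ fx γ → γ⁻¹ • x = x := by
    intro x hx
    rw [inv_smul_eq_iff]; exact hx.symm
  have hDfix : ∀ i x, x ∈ fx γ → D i • x = x := by
    intro i x hx
    rw [hD, hfixi x hx, W.tt]
  refine ⟨g, fun i => ⟨S i, by rw [hSi]⟩, ?_, ?_⟩
  · intro i x hx
    change g i • x = x
    have : γ • x = x := hx
    rw [hg, mul_smul, this, hDfix i x hx]
  · intro i j hij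
    rw [hgg]
    refine ⟨hDD i j, ?_⟩
    ext x
    constructor
    · intro hx
      by_contra hne
      have hx : (D i * D j) • x = x := hx
      have hen : enc n (γ⁻¹ • x) ≠ enc n x := by
        intro h
        have := eq_of_enc hni h
        rw [inv_smul_eq_iff] at this
        exact hne this.symm
      have q1 := enc_lt n (γ⁻¹ • x)
      have q2 := enc_lt n x
      rw [mul_smul, hD, hD, hφt _ _ _ (hφn _ _), hφt _ _ _ (hφn _ _), hφγ _ _ _ (hφn _ _),
        hφγ _ _ _ (hφn _ _)] at hx
      have hfar : ∀ y z, φ i y ≠ φ j z := by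
        intro y z h
        have q1 := enc_lt n y
        have q2 := enc_lt n z
        have h : n + i * encq B n + enc n y = n + j * encq B n + enc n z := h
        rcases lt_or_gt_of_ne hij with h' | h'
        · have := Nat.mul_le_mul_right (encq B n) (show i + 1 ≤ j by omega)
          rw [add_mul] at this; omega
        · have := Nat.mul_le_mul_right (encq B n) (show j + 1 ≤ i by omega)
          rw [add_mul] at this; omega
      have := congrArg (W.e (φ i x)) hx
      rw [W.et, W.e_t_ne (by simp only [φ]; omega), W.e_t_ne (hfar _ _), W.e_t_ne (hfar _ _)] at this
      simp at this
    · intro hx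
      change (D i * D j) • x = x
      rw [mul_smul, hDfix j x hx, hDfix i x hx]

end Windows

/-- involutions of level `n` fixing `A` -/
def invSet (n : ℕ) (A : Set B.Path) : Set ↥B.fullGroup :=
  {s | s ∈ B.levelIn n ∧ s * s = 1 ∧ A ⊆ fx s}

theorem mem_closure_inv {n : ℕ} {A : Set B.Path} (γ : ↥B.fullGroup) (hγ : γ ∈ B.levelIn n)
    (hA : A ⊆ fx γ) : γ ∈ Subgroup.closure (invSet n A) := by
  classical
  let moved : ↥B.fullGroup → Set (∀ i : Fin n, B.E i) := fun g => {p | ∃ x, pre n x = p ∧ g • x ≠ x}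
  suffices H : ∀ N : ℕ, ∀ γ : ↥B.fullGroup, γ ∈ B.levelIn n → A ⊆ fx γ → (moved γ).ncard ≤ N →
      γ ∈ Subgroup.closure (invSet n A) from H _ γ hγ hA le_rfl
  intro N
  induction N with
  | zero =>
    intro γ hγ hA h
    have h0 : moved γ = ∅ := by
      rw [← Set.ncard_eq_zero (Set.toFinite _)]; omega
    have : γ = 1 := by
      apply group_ext
      intro x
      by_contra hx
      have : pre n x ∈ moved γ := ⟨x, rfl, by simpa using hx⟩
      rw [h0] at this; exact this
    rw [this]; exact one_mem _
  | succ N ih =>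
    intro γ hγ hA h
    by_cases h1 : γ = 1
    · rw [h1]; exact one_mem _
    obtain ⟨x0, hx0⟩ : ∃ x0 : B.Path, γ • x0 ≠ x0 := by
      by_contra hcon
      push Not at hcon
      exact h1 (group_ext fun x => by rw [hcon, one_smul])
    have hγi : γ⁻¹ ∈ B.levelIn n := inv_mem hγ
    have preγ : ∀ {g : ↥B.fullGroup}, g ∈ B.levelIn n → ∀ {x y : B.Path}, pre n x = pre n y →
        pre n (g • x) = pre n (g • y) := by
      intro g hg x y hxy
      rw [pre_eq] at hxy ⊢
      exact smul_congr hg hxy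
    have hne : pre n (γ • x0) ≠ pre n x0 := by
      intro h
      apply hx0
      exact eq_of_enc hγ (enc_eq.2 (pre_eq.1 h))
    let F : B.Path → B.Path := fun x => if pre n x = pre n x0 then γ • x else
      if pre n x = pre n (γ • x0) then γ⁻¹ • x else x
    have hFF : ∀ x, F (F x) = x := by
      intro x
      by_cases c1 : pre n x = pre n x0
      · have c2 := preγ hγ c1
        simp only [F, c1, if_true, c2, hne, if_false, inv_smul_smul]
      · by_cases c2 : pre n x = pre n (γ • x0)
        · have c3 : pre n (γ⁻¹ • x) = pre n x0 := by
            rw [preγ hγi c2, inv_smul_smul]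
          simp only [F, c2, hne, if_true, if_false, c3, smul_inv_smul]
        · simp only [F, c1, c2, if_false]
    let s := mkInv F hFF n (by
      intro x i hi
      simp only [F]
      split_ifs
      · exact smul_tail hγ x hi
      · exact smul_tail hγi x hi
      · rfl) (by
      intro x y hxy i hi
      simp only [F, pre_eq.2 hxy]
      split_ifs
      · exact smul_congr hγ hxy i hi
      · exact smul_congr hγi hxy i hi
      · exact hxy i hi)
    have hs : ∀ x, s • x = F x := fun x => rfl
    have hsl : s ∈ B.levelIn n := mkInv_level ..
    have hss : s * s = 1 := mkInv_sq ..
    have hfix : fx γ ⊆ fx s := by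
      intro x hx
      have hx' : γ • x = x := hx
      have hcyl := cyl_fx hγ
      have c1 : pre n x ≠ pre n x0 := by
        intro h
        exact hx0 (hcyl x x0 (pre_eq.1 h) hx)
      have c2 : pre n x ≠ pre n (γ • x0) := by
        intro h
        exact hx0 (smul_left_cancel γ (hcyl x (γ • x0) (pre_eq.1 h) hx))
      change s • x = x
      rw [hs]
      simp only [F, c1, c2, if_false]
    have hsub : fx γ ⊆ fx (s * γ) := by
      intro x hx
      change (s * γ) • x = x
      rw [mul_smul, show γ • x = x from hx]
      exact hfix hx
    have hmem : s * γ ∈ Subgroup.closure (invSet n A) := by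
      apply ih _ (mul_mem hsl hγ) (hA.trans hsub)
      have hlt : (moved (s * γ)).ncard < (moved γ).ncard := by
        apply Set.ncard_lt_ncard _ (Set.toFinite _)
        rw [Set.ssubset_iff_of_subset]
        · refine ⟨pre n x0, ⟨x0, rfl, hx0⟩, ?_⟩
          rintro ⟨x, hx, hxm⟩
          apply hxm
          have c2 := preγ hγ hx
          rw [mul_smul, hs]
          simp only [F, c2, hne, if_true, if_false, inv_smul_smul]
        · rintro p ⟨x, rfl, hx⟩
          exact ⟨x, rfl, fun h => hx (hsub h)⟩
      omega
    have : γ = s * (s * γ) := by rw [← mul_assoc, hss, one_mul]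
    rw [this]
    exact mul_mem (Subgroup.subset_closure ⟨hsl, hss, hA.trans hfix⟩) hmem

instance finite_levelIn (n : ℕ) : Finite (B.levelIn n) := by
  classical
  let R : (∀ i : Fin n, B.E i) → Option B.Path := fun p =>
    if h : ∃ x, pre n x = p then some h.choose else none
  let f : B.levelIn n → (∀ i : Fin n, B.E i) → Option (∀ i : Fin n, B.E i) := fun g p =>
    (R p).map fun x => pre n (g.1 • x)
  apply Finite.of_injective f
  intro g h hgh
  apply Subtype.ext
  apply group_ext
  intro x
  have hex : ∃ y : B.Path, pre n y = pre n x := ⟨x, rfl⟩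
  have := congrFun hgh (pre n x)
  simp only [f, R, dif_pos hex, Option.map_some, Option.some_inj] at this
  have hc := pre_eq.1 hex.choose_spec
  have h2 := pre_eq.1 this
  apply path_ext
  intro i
  rcases lt_or_ge i n with hi | hi
  · rw [← smul_congr g.2 hc i hi, ← smul_congr h.2 hc i hi]
    exact h2 i hi
  · rw [smul_tail g.2 x hi, smul_tail h.2 x hi]

instance countable_fullGroup : Countable ↥B.fullGroup := by
  have h : (Set.univ : Set ↥B.fullGroup) = ⋃ n, (B.levelIn n : Set ↥B.fullGroup) := by
    ext g
    simpa using exists_levelIn g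
  rw [← Set.countable_univ_iff, h]
  exact Set.countable_iUnion fun n => (show Finite (B.levelIn n) from finite_levelIn n).to_countable

end BratteliDiagram

section GNS
variable {G : Type} [Group G] {χ : G → ℂ}

theorem IsCharacter.inv (hχ : IsCharacter G χ) (g : G) : χ g⁻¹ = (starRingEnd ℂ) (χ g) := by
  obtain ⟨h1, -, h3⟩ := hχ
  have a := (Complex.le_def.1 (h3 2 ![g, 1] ![1, 1])).2
  have b := (Complex.le_def.1 (h3 2 ![g, 1] ![1, Complex.I])).2
  simp [Fin.sum_univ_two, h1] at a b
  apply Complex.ext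
  · simp; linarith
  · simp; linarith

theorem IsCharacter.conj (hχ : IsCharacter G χ) (g h : G) : χ (g * h * g⁻¹) = χ h := by
  rw [hχ.2.1]; congr 1; group

/-- the inner product of the GNS construction -/
def gnsCore (hχ : IsCharacter G χ) : PreInnerProductSpace.Core ℂ (G →₀ ℂ) where
  inner f g := f.sum fun a c => g.sum fun b d => (starRingEnd ℂ) c * d * χ (a * b⁻¹)
  conj_inner_symm x y := by
    simp only [Finsupp.sum, map_sum, map_mul, Complex.conj_conj]
    rw [Finset.sum_comm]
    refine Finset.sum_congr rfl fun a _ => Finset.sum_congr rfl fun b _ => ?_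
    rw [← hχ.inv, mul_inv_rev, inv_inv]; ring
  re_inner_nonneg x := by
    have := hχ.2.2 x.support.card (fun i => (x.support.equivFin.symm i : G))
      (fun i => x (x.support.equivFin.symm i))
    have h := (Complex.le_def.1 this).1
    refine le_of_le_of_eq h ?_
    change _ = Complex.re _
    congr 1
    simp only [Finsupp.sum]
    rw [← Finset.sum_coe_sort x.support]
    rw [← Equiv.sum_comp x.support.equivFin.symm]
    refine Finset.sum_congr rfl fun a _ => ?_
    rw [← Finset.sum_coe_sort x.support]
    rw [← Equiv.sum_comp x.support.equivFin.symm]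
  add_left x y z := by
    rw [Finsupp.sum_add_index']
    · simp
    · intro a b c
      simp [add_mul, Finsupp.sum, Finset.sum_add_distrib]
  smul_left x y r := by
    rw [Finsupp.sum_smul_index']
    · simp only [Finsupp.sum, Finset.mul_sum]
      refine Finset.sum_congr rfl fun a _ => Finset.sum_congr rfl fun b _ => ?_
      simp; ring
    · simp

theorem exists_gns (hχ : IsCharacter G χ) :
    ∃ (V : Type) (_ : SeminormedAddCommGroup V) (_ : InnerProductSpace ℂ V) (ξ : G → V),
      ∀ g h, inner ℂ (ξ g) (ξ h) = χ (g * h⁻¹) := by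
  let c := gnsCore hχ
  let i1 : SeminormedAddCommGroup (G →₀ ℂ) := @InnerProductSpace.Core.toSeminormedAddCommGroup ℂ _ _ _ _ c
  let i2 : InnerProductSpace ℂ (G →₀ ℂ) := InnerProductSpace.ofCore c
  refine ⟨G →₀ ℂ, i1, i2, fun g => Finsupp.single g 1, fun g h => ?_⟩
  change (Finsupp.single g (1:ℂ)).sum (fun a c => (Finsupp.single h (1:ℂ)).sum
    fun b d => (starRingEnd ℂ) c * d * χ (a * b⁻¹)) = _
  simp

end GNS

section Hilb
variable {V : Type*} [SeminormedAddCommGroup V] [InnerProductSpace ℂ V]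

theorem norm_sum_sq_le (y : ℕ → V) (horth : ∀ i j, i ≠ j → inner ℂ (y i) (y j) = 0)
    (hb : ∀ i, ‖y i‖ ≤ 2) (N : ℕ) : ‖∑ j ∈ Finset.range N, y j‖ ^ 2 ≤ 4 * N := by
  induction N with
  | zero => simp
  | succ N ih =>
    have h0 : inner ℂ (∑ j ∈ Finset.range N, y j) (y N) = 0 := by
      rw [sum_inner]
      apply Finset.sum_eq_zero
      intro i hi
      exact horth i N (by have := Finset.mem_range.1 hi; omega)
    rw [Finset.sum_range_succ, norm_add_sq (𝕜 := ℂ), h0]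
    have := hb N
    have h0 := norm_nonneg (y N)
    push_cast
    simp
    nlinarith

theorem norm_avg_sq (v : ℕ → V) (p : ℝ) (h1 : ∀ i, inner ℂ (v i) (v i) = 1)
    (h2 : ∀ i j, i ≠ j → inner ℂ (v i) (v j) = (p : ℂ)) (N : ℕ) (hN : 0 < N) :
    ‖((N : ℂ)⁻¹) • ∑ j ∈ Finset.range N, v j‖ ^ 2 = p + (1 - p) / N := by
  have key : inner ℂ (∑ j ∈ Finset.range N, v j) (∑ j ∈ Finset.range N, v j) =
      ((N * (N * p + (1 - p)) : ℝ) : ℂ) := by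
    rw [sum_inner]
    simp only [inner_sum]
    have : ∀ i ∈ Finset.range N, ∑ j ∈ Finset.range N, inner ℂ (v i) (v j) =
        (N * p + (1 - p) : ℂ) := by
      intro i hi
      have e : ∀ j ∈ Finset.range N, inner ℂ (v i) (v j) = (p : ℂ) + if i = j then (1 - p : ℂ) else 0 := by
        intro j _
        split_ifs with h
        · rw [← h, h1]; ring
        · rw [h2 i j h, add_zero]
      rw [Finset.sum_congr rfl e, Finset.sum_add_distrib, Finset.sum_ite_eq, if_pos hi]
      simp
    rw [Finset.sum_congr rfl this]
    simp
    ring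
  have hn : ‖∑ j ∈ Finset.range N, v j‖ ^ 2 = N * (N * p + (1 - p)) := by
    rw [@norm_sq_eq_re_inner ℂ, key]
    exact Complex.ofReal_re _
  rw [norm_smul, mul_pow, hn]
  simp
  have : (N : ℝ) ≠ 0 := by positivity
  field_simp

end Hilb

namespace BratteliDiagram
variable {B : BratteliDiagram} {χ : ↥B.fullGroup → ℂ}

theorem chi_inv (W : Windows B) (hχ : IsCharacter ↥B.fullGroup χ) {s t : ↥B.fullGroup}
    (hs : s * s = 1) (ht : t * t = 1) (h : fx s = fx t) : χ s = χ t := by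
  obtain ⟨θ, -, rfl⟩ := W.conj_inv hs ht h
  rw [hχ.conj]

theorem chi_inv_real (hχ : IsCharacter ↥B.fullGroup χ) {s : ↥B.fullGroup}
    (hs : s * s = 1) : ((χ s).re : ℂ) = χ s := by
  have := hχ.inv s
  rw [inv_eq_of_mul_eq_one_right hs] at this
  exact Complex.conj_eq_iff_re.1 this.symm

namespace Windows
theorem T_T_sq (W : Windows B) {n i j : ℕ} (hi : n ≤ i) (hj : n ≤ j) {A C : Set B.Path}
    (hA : Cyl n A) (hC : Cyl n C) :
    W.T A i * W.T C j * (W.T A i * W.T C j) = 1 := by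
  calc _ = W.T A i * W.T C j * (W.T C j * W.T A i) := by rw [W.T_comm hi hj hA hC]
    _ = W.T A i * (W.T C j * W.T C j) * W.T A i := by group
    _ = 1 := by rw [W.T_sq hj hC, mul_one, W.T_sq hi hA]

theorem T_inv (W : Windows B) {n j : ℕ} (h : n ≤ j) {A : Set B.Path} (hA : Cyl n A) :
    (W.T A j)⁻¹ = W.T A j := inv_eq_of_mul_eq_one_right (W.T_sq h hA)

theorem s_T_T_sq (W : Windows B) {n i j : ℕ} (hi : n ≤ i) (hj : n ≤ j) {A : Set B.Path}
    (hA : Cyl n A) {s : ↥B.fullGroup} (hs : s * s = 1) (hsn : s ∈ B.levelIn n) (hAs : A ⊆ fx s) :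
    s * (W.T A i * W.T A j) * (s * (W.T A i * W.T A j)) = 1 := by
  have c : s * (W.T A i * W.T A j) = (W.T A i * W.T A j) * s := by
    rw [← mul_assoc, W.T_smul_comm hi hsn hA hAs, mul_assoc, W.T_smul_comm hj hsn hA hAs, mul_assoc]
  calc s * (W.T A i * W.T A j) * (s * (W.T A i * W.T A j))
      = (W.T A i * W.T A j) * s * (s * (W.T A i * W.T A j)) := by rw [c]
    _ = (W.T A i * W.T A j) * (s * s) * (W.T A i * W.T A j) := by group
    _ = 1 := by rw [hs, mul_one, W.T_T_sq hi hj hA hA]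
end Windows

theorem weak_limit (W : Windows B) (hχ : IsCharacter ↥B.fullGroup χ) {n : ℕ} {A : Set B.Path}
    (hA : Cyl n A) {γ : ↥B.fullGroup} (hγ : γ ∈ B.levelIn n) (hAγ : A ⊆ fx γ) :
    Tendsto (fun N : ℕ => (N : ℂ)⁻¹ * ∑ j ∈ Finset.range N, χ (γ * W.T A (n + j))) atTop
      (nhds (χ (W.T A n))) := by
  obtain ⟨V, i1, i2, ξ, hξ⟩ := exists_gns hχ
  have hn : ∀ g, ‖ξ g‖ = 1 := by
    intro g
    have h2 : ‖ξ g‖ ^ 2 = 1 := by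
      rw [@norm_sq_eq_re_inner ℂ, hξ, mul_inv_cancel, hχ.1]; simp
    nlinarith [norm_nonneg (ξ g)]
  have hT : ∀ j, χ (W.T A (n + j)) = χ (W.T A n) := fun j =>
    chi_inv W hχ (W.T_sq (by omega) hA) (W.T_sq le_rfl hA)
      (by rw [W.fx_T (by omega) hA, W.fx_T le_rfl hA])
  have hmem := mem_closure_inv γ hγ hAγ
  have hclos : ∀ s ∈ invSet n A, ∀ δ : ↥B.fullGroup,
      Tendsto (fun N : ℕ => (N : ℂ)⁻¹ * ∑ j ∈ Finset.range N, χ (δ * W.T A (n + j))) atTop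
      (nhds (χ (W.T A n))) →
      Tendsto (fun N : ℕ => (N : ℂ)⁻¹ * ∑ j ∈ Finset.range N, χ (δ * s * W.T A (n + j))) atTop
      (nhds (χ (W.T A n))) := by
    rintro s ⟨hsn, hss, hAs⟩ δ hδ
    let y : ℕ → V := fun j => ξ (s * W.T A (n + j)) - ξ (W.T A (n + j))
    have hsi : s⁻¹ = s := inv_eq_of_mul_eq_one_right hss
    have hTi : ∀ j, (W.T A (n + j))⁻¹ = W.T A (n + j) := fun j => W.T_inv (by omega) hA
    have hsc : ∀ j, s * W.T A (n + j) = W.T A (n + j) * s := fun j =>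
      W.T_smul_comm (by omega) hsn hA hAs
    have horth : ∀ i j, i ≠ j → inner ℂ (y i) (y j) = 0 := by
      intro i j hij
      simp only [y, inner_sub_left, inner_sub_right, hξ]
      have e1 : χ (s * W.T A (n + i) * (s * W.T A (n + j))⁻¹) =
          χ (W.T A (n + i) * W.T A (n + j)) := by
        rw [mul_inv_rev, hTi, ← hχ.conj s (W.T A (n + i) * W.T A (n + j))]
        simp only [mul_assoc]
      have e2 : χ (s * W.T A (n + i) * (W.T A (n + j))⁻¹) =
          χ (W.T A (n + i) * W.T A (n + j)) := by
        rw [hTi, mul_assoc]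
        apply chi_inv W hχ (W.s_T_T_sq (by omega) (by omega) hA hss hsn hAs)
          (W.T_T_sq (by omega) (by omega) hA hA)
        rw [W.fx_mul_T_T (by omega) (by omega) (by omega) hsn hA hAs,
          W.fx_T_T (by omega) (by omega) (by omega) hA hA, Set.inter_self]
      have e3 : χ (W.T A (n + i) * (s * W.T A (n + j))⁻¹) =
          χ (W.T A (n + i) * W.T A (n + j)) := by
        rw [← e2, mul_inv_rev, hTi, hsi, ← mul_assoc, hχ.2.1, mul_assoc]
      rw [e1, e2, e3, hTi]; ring
    have hyb : ∀ j, ‖y j‖ ≤ 2 := by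
      intro j
      refine (norm_sub_le _ _).trans ?_
      rw [hn, hn]; norm_num
    have hdiff : ∀ N : ℕ, (N : ℂ)⁻¹ * ∑ j ∈ Finset.range N, χ (δ * s * W.T A (n + j)) =
        (N : ℂ)⁻¹ * ∑ j ∈ Finset.range N, χ (δ * W.T A (n + j)) +
        (N : ℂ)⁻¹ * inner ℂ (ξ δ) (∑ j ∈ Finset.range N, y j) := by
      intro N
      rw [← mul_add, inner_sum, ← Finset.sum_add_distrib]
      congr 1
      refine Finset.sum_congr rfl fun j _ => ?_
      simp only [y, inner_sub_right, hξ, mul_inv_rev, hTi, hsi]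
      rw [mul_assoc δ s, hsc]
      ring
    have h0 : Tendsto (fun N : ℕ => (N : ℂ)⁻¹ * inner ℂ (ξ δ) (∑ j ∈ Finset.range N, y j)) atTop
        (nhds 0) := by
      have hs : Tendsto (fun N : ℕ => 2 * (Real.sqrt N)⁻¹) atTop (nhds 0) := by
        have := (tendsto_inv_atTop_zero.comp
          (Real.tendsto_sqrt_atTop.comp tendsto_natCast_atTop_atTop)).const_mul (2:ℝ)
        simpa using this
      apply squeeze_zero_norm _ hs
      intro N
      rcases Nat.eq_zero_or_pos N with rfl | hN
      · simp
      have hNr : (0:ℝ) < N := by exact_mod_cast hN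
      have b1 : ‖∑ j ∈ Finset.range N, y j‖ ≤ 2 * Real.sqrt N := by
        apply le_of_sq_le_sq _ (by positivity)
        rw [mul_pow, Real.sq_sqrt hNr.le]
        have := norm_sum_sq_le y horth hyb N
        linarith
      have b2 := norm_inner_le_norm (𝕜 := ℂ) (ξ δ) (∑ j ∈ Finset.range N, y j)
      rw [hn, one_mul] at b2
      rw [norm_mul, norm_inv, Complex.norm_natCast]
      calc (N:ℝ)⁻¹ * ‖inner ℂ (ξ δ) (∑ j ∈ Finset.range N, y j)‖ ≤ (N:ℝ)⁻¹ * (2 * Real.sqrt N) := by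
            gcongr; exact b2.trans b1
        _ = 2 * (Real.sqrt N)⁻¹ := by
            have hsp := Real.sqrt_pos.2 hNr
            have := Real.sq_sqrt hNr.le
            field_simp
            linarith
    simp only [hdiff]
    simpa using hδ.add h0
  refine Subgroup.closure_induction_right (p := fun γ _ => Tendsto (fun N : ℕ => (N : ℂ)⁻¹ *
    ∑ j ∈ Finset.range N, χ (γ * W.T A (n + j))) atTop (nhds (χ (W.T A n)))) ?_ ?_ ?_ hmem
  · simp only [one_mul, hT]
    apply tendsto_const_nhds.congr'
    filter_upwards [eventually_gt_atTop 0] with N hN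
    have : (N : ℂ) ≠ 0 := by exact_mod_cast hN.ne'
    simp; field_simp
  · intro x _ s hs h
    exact hclos s hs x h
  · intro x _ s hs h
    rw [inv_eq_of_mul_eq_one_right hs.2.1]
    exact hclos s hs x h

theorem chi_eq_inv (W : Windows B) (hχ : IsCharacter ↥B.fullGroup χ) (γ s : ↥B.fullGroup)
    (hs : s * s = 1) (h : fx s = fx γ) : χ γ = χ s := by
  obtain ⟨V, i1, i2, ξ, hξ⟩ := exists_gns hχ
  have hξ1 : ∀ g, inner ℂ (ξ g) (ξ g) = 1 := fun g => by rw [hξ, mul_inv_cancel, hχ.1]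
  have hn : ∀ g, ‖ξ g‖ = 1 := by
    intro g
    have h2 : ‖ξ g‖ ^ 2 = 1 := by
      rw [@norm_sq_eq_re_inner ℂ, hξ1]; simp
    nlinarith [norm_nonneg (ξ g)]
  obtain ⟨g, hg1, hg2, hg3⟩ := W.exists_seq γ
  have hgγ : ∀ i, χ (g i) = χ γ := by
    intro i
    obtain ⟨θ, hθ⟩ := hg1 i
    rw [hθ, hχ.conj]
  set p : ℝ := (χ s).re with hp
  have hps : (p : ℂ) = χ s := chi_inv_real hχ hs
  rw [← hps]
  have main : ∀ N0 : ℕ, 0 < N0 → ‖χ γ - p‖ ^ 2 ≤ (1 - p) / N0 := by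
    intro N0 hN0
    obtain ⟨n0, hn0⟩ := exists_levelIn γ
    choose l hl using fun i => exists_levelIn (g i)
    set n := n0 + ∑ i ∈ Finset.range N0, l i with hnn
    have hgn : ∀ i ∈ Finset.range N0, g i ∈ B.levelIn n := by
      intro i hi
      refine levelIn_mono ?_ (hl i)
      have := Finset.single_le_sum (f := l) (fun _ _ => Nat.zero_le _) hi
      omega
    have hA : Cyl n (fx γ) := (cyl_fx hn0).mono (by omega)
    have hTp : ∀ j, χ (W.T (fx γ) (n + j)) = p := by
      intro j
      rw [hps]
      exact chi_inv W hχ (W.T_sq (by omega) hA) hs (by rw [W.fx_T (by omega) hA, h])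
    have hTTp : ∀ i j, i ≠ j → inner ℂ (ξ (W.T (fx γ) (n + i))) (ξ (W.T (fx γ) (n + j))) = p := by
      intro i j hij
      rw [hξ, hps, W.T_inv (by omega) hA]
      apply chi_inv W hχ (W.T_T_sq (by omega) (by omega) hA hA) hs
      rw [W.fx_T_T (by omega) (by omega) (by omega) hA hA, h, Set.inter_self]
    set u : V := ((N0 : ℂ)⁻¹) • ∑ i ∈ Finset.range N0, ξ (g i) with hu
    let η : ℕ → V := fun N => ((N : ℂ)⁻¹) • ∑ j ∈ Finset.range N, ξ (W.T (fx γ) (n + j))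
    have hun : ‖u‖ ^ 2 = p + (1 - p) / N0 := by
      apply norm_avg_sq (fun i => ξ (g i)) p (fun i => hξ1 _) _ N0 hN0
      intro i j hij
      rw [hξ, hps]
      exact chi_inv W hχ (hg3 i j hij).1 hs ((hg3 i j hij).2.trans h.symm)
    have hηn : ∀ N, 0 < N → ‖η N‖ ^ 2 = p + (1 - p) / N := fun N hN =>
      norm_avg_sq (fun j => ξ (W.T (fx γ) (n + j))) p (fun i => hξ1 _) hTTp N hN
    have hu1 : inner ℂ u (ξ 1) = χ γ := by
      have : (N0 : ℂ) ≠ 0 := by exact_mod_cast hN0.ne'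
      rw [hu, inner_smul_left, sum_inner]
      simp [hξ, hgγ]
      field_simp
    have hη1 : ∀ N, 0 < N → inner ℂ (η N) (ξ 1) = p := by
      intro N hN
      have : (N : ℂ) ≠ 0 := by exact_mod_cast hN.ne'
      simp only [η]
      rw [inner_smul_left, sum_inner]
      simp [hξ, hTp]
      field_simp
    have hlim : Tendsto (fun N => inner ℂ u (η N)) atTop (nhds (p : ℂ)) := by
      have e : ∀ N, inner ℂ u (η N) = (N0 : ℂ)⁻¹ * ∑ i ∈ Finset.range N0,
          ((N : ℂ)⁻¹ * ∑ j ∈ Finset.range N, χ (g i * W.T (fx γ) (n + j))) := by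
        intro N
        simp only [hu, η]
        rw [inner_smul_left, inner_smul_right, sum_inner]
        have hTi : ∀ j, (W.T (fx γ) (n + j))⁻¹ = W.T (fx γ) (n + j) := fun j =>
          W.T_inv (by omega) hA
        simp only [inner_sum, hξ, hTi]
        rw [← Finset.mul_sum]; simp
      simp only [e]
      have hx : Tendsto (fun N : ℕ => (N0 : ℂ)⁻¹ * ∑ i ∈ Finset.range N0,
          ((N : ℂ)⁻¹ * ∑ j ∈ Finset.range N, χ (g i * W.T (fx γ) (n + j)))) atTop
          (nhds ((N0 : ℂ)⁻¹ * ∑ i ∈ Finset.range N0, χ (W.T (fx γ) n))) := by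
        apply Tendsto.const_mul
        apply tendsto_finsetSum
        intro i hi
        exact weak_limit W hχ hA (hgn i hi) (hg2 i)
      have hTp0 := hTp 0
      rw [add_zero] at hTp0
      have : (N0 : ℂ)⁻¹ * ∑ i ∈ Finset.range N0, χ (W.T (fx γ) n) = p := by
        have : (N0 : ℂ) ≠ 0 := by exact_mod_cast hN0.ne'
        rw [hTp0]; simp; field_simp
      rwa [this] at hx
    have hlim2 : Tendsto (fun N => ‖u‖ ^ 2 - 2 * (inner ℂ u (η N)).re + ‖η N‖ ^ 2) atTop
        (nhds ((p + (1 - p) / N0) - 2 * p + p)) := by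
      rw [hun]
      apply Tendsto.add
      · apply Tendsto.const_sub
        apply Tendsto.const_mul
        exact (Complex.continuous_re.tendsto (p : ℂ)).comp hlim
      · have : Tendsto (fun N : ℕ => p + (1 - p) / (N : ℝ)) atTop (nhds (p + 0)) :=
          (tendsto_const_div_atTop_nhds_zero_nat _).const_add p
        rw [add_zero] at this
        apply this.congr'
        filter_upwards [eventually_gt_atTop 0] with N hN
        exact (hηn N hN).symm
    have e : (p + (1 - p) / N0) - 2 * p + p = (1 - p) / N0 := by ring
    rw [e] at hlim2
    apply ge_of_tendsto hlim2
    filter_upwards [eventually_gt_atTop 0] with N hN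
    have b := norm_inner_le_norm (𝕜 := ℂ) (u - η N) (ξ 1)
    rw [inner_sub_left, hu1, hη1 N hN, hn, mul_one] at b
    have b2 : ‖u - η N‖ ^ 2 = ‖u‖ ^ 2 - 2 * (inner ℂ u (η N)).re + ‖η N‖ ^ 2 :=
      norm_sub_sq (𝕜 := ℂ) _ _
    rw [← b2]
    gcongr
  have hz : ‖χ γ - p‖ ^ 2 ≤ 0 := by
    have := tendsto_const_div_atTop_nhds_zero_nat (1 - p)
    apply ge_of_tendsto this
    filter_upwards [eventually_gt_atTop 0] with N hN
    exact main N hN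
  have : ‖χ γ - p‖ = 0 := by
    have := norm_nonneg (χ γ - p)
    nlinarith
  exact sub_eq_zero.1 (norm_eq_zero.1 this)

theorem chi_fx (W : Windows B) (hχ : IsCharacter ↥B.fullGroup χ) {g h : ↥B.fullGroup}
    (e : fx g = fx h) : χ g = χ h := by
  obtain ⟨n, hn⟩ := exists_levelIn g
  have hA := cyl_fx hn
  have h1 := W.T_sq le_rfl hA
  have h2 := W.fx_T le_rfl hA
  rw [chi_eq_inv W hχ g _ h1 h2, chi_eq_inv W hχ h _ h1 (h2.trans e)]

theorem chi_real (W : Windows B) (hχ : IsCharacter ↥B.fullGroup χ) (g : ↥B.fullGroup) :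
    ((χ g).re : ℂ) = χ g := by
  obtain ⟨n, hn⟩ := exists_levelIn g
  have hA := cyl_fx hn
  have h1 := W.T_sq le_rfl hA
  have h2 := W.fx_T le_rfl hA
  rw [chi_eq_inv W hχ g _ h1 h2, chi_inv_real hχ h1]

end BratteliDiagram

section Moment
variable {G : Type} {R : Type*} [CommRing R] (L : R →+ ℝ) (x : G → R)

/-- the event that all coordinates in `K` are `true` -/
def evK (K : Finset G) : Set (G → Bool) := {D | ∀ k ∈ K, D k = true}

theorem evK_eq (K : Finset G) : evK K = ⋂ k ∈ K, (fun D : G → Bool => D k) ⁻¹' {true} := by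
  ext D; simp [evK]

theorem measurableSet_evK (K : Finset G) : MeasurableSet (evK K) := by
  rw [evK_eq]
  exact Finset.measurableSet_biInter _ fun k _ => measurable_pi_apply k (measurableSet_singleton _)

theorem isClopen_evK (K : Finset G) : IsClopen (evK K) := by
  rw [evK_eq]
  exact isClopen_biInter_finset fun k _ => (isClopen_discrete _).preimage (continuous_apply k)

open Classical in
/-- atoms -/
def atomR (J I : Finset G) : R := (∏ i ∈ I, x i) * ∏ j ∈ J \ I, (1 - x j)

variable {x}

theorem atomR_idem (hx : ∀ g, x g * x g = x g) (J I : Finset G) :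
    atomR x J I * atomR x J I = atomR x J I := by
  unfold atomR
  rw [mul_mul_mul_comm, ← Finset.prod_mul_distrib, ← Finset.prod_mul_distrib]
  congr 1
  · exact Finset.prod_congr rfl fun i _ => hx i
  · refine Finset.prod_congr rfl fun i _ => ?_
    linear_combination hx i

open Classical in
theorem prod_atomR (hx : ∀ g, x g * x g = x g) {J I K : Finset G} (hK : K ⊆ J) :
    (∏ k ∈ K, x k) * atomR x J I = if K ⊆ I then atomR x J I else 0 := by
  split_ifs with h
  · unfold atomR
    rw [← mul_assoc]
    congr 1
    rw [← Finset.prod_sdiff h, mul_comm, mul_assoc, ← Finset.prod_mul_distrib]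
    congr 1
    exact Finset.prod_congr rfl fun i _ => hx i
  · obtain ⟨k, hk, hkI⟩ := Finset.not_subset.1 h
    obtain ⟨a, ha⟩ := Finset.dvd_prod_of_mem x hk
    have hkJ : k ∈ J \ I := Finset.mem_sdiff.2 ⟨hK hk, hkI⟩
    obtain ⟨b, hb⟩ := Finset.dvd_prod_of_mem (fun j => 1 - x j) hkJ
    unfold atomR
    rw [ha, hb]
    linear_combination (-a * (∏ i ∈ I, x i) * b) * hx k

theorem sum_atomR (J : Finset G) : ∑ I ∈ J.powerset, atomR x J I = 1 := by
  classical
  have := Finset.prod_add x (fun j => 1 - x j) J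
  simp only [add_sub_cancel, Finset.prod_const_one] at this
  rw [this]
  refine Finset.sum_congr rfl fun I _ => ?_
  unfold atomR
  congr!

open Classical in
/-- finite-dimensional approximations -/
def nuJ (x : G → R) (J : Finset G) : Measure (G → Bool) :=
  ∑ I ∈ J.powerset, ENNReal.ofReal (L (atomR x J I)) • Measure.dirac (fun g => decide (g ∈ I))

theorem nuJ_evK (hx : ∀ g, x g * x g = x g) (hL : ∀ f, 0 ≤ L (f * f)) {J K : Finset G}
    (hK : K ⊆ J) : nuJ L x J (evK K) = ENNReal.ofReal (L (∏ k ∈ K, x k)) := by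
  classical
  have hpos : ∀ I, 0 ≤ L (atomR x J I) := fun I => by
    rw [← atomR_idem hx]; exact hL _
  have e : L (∏ k ∈ K, x k) = ∑ I ∈ J.powerset, if K ⊆ I then L (atomR x J I) else 0 := by
    conv_lhs => rw [← mul_one (∏ k ∈ K, x k), ← sum_atomR (x := x) J, Finset.mul_sum, map_sum]
    refine Finset.sum_congr rfl fun I _ => ?_
    rw [prod_atomR hx hK]
    split_ifs <;> simp
  rw [e, ENNReal.ofReal_sum_of_nonneg (by intro I _; split_ifs; exact hpos I; exact le_rfl)]
  unfold nuJ
  rw [Measure.finsetSum_apply]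
  refine Finset.sum_congr rfl fun I _ => ?_
  rw [Measure.smul_apply, Measure.dirac_apply' _ (measurableSet_evK K)]
  have hm : (fun g => decide (g ∈ I)) ∈ evK K ↔ K ⊆ I := by
    simp only [evK, Set.mem_setOf_eq, decide_eq_true_eq]; rfl
  by_cases h : K ⊆ I
  · rw [Set.indicator_of_mem (hm.2 h), if_pos h]; simp
  · rw [Set.indicator_of_notMem (fun hh => h (hm.1 hh)), if_neg h]; simp

theorem exists_nu [Countable G] (hx : ∀ g, x g * x g = x g) (hL : ∀ f, 0 ≤ L (f * f))
    (h1 : L 1 = 1) :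
    ∃ ν : Measure (G → Bool), IsProbabilityMeasure ν ∧
      ∀ K : Finset G, ν (evK K) = ENNReal.ofReal (L (∏ k ∈ K, x k)) := by
  classical
  have hprob : ∀ J, IsProbabilityMeasure (nuJ L x J) := by
    intro J
    constructor
    have := nuJ_evK L hx hL (Finset.empty_subset J)
    have e : evK (∅ : Finset G) = Set.univ := by ext; simp [evK]
    rw [e] at this
    rw [this]; simp [h1]
  let P : Finset G → ProbabilityMeasure (G → Bool) := fun J => ⟨nuJ L x J, hprob J⟩
  let U : Ultrafilter (Finset G) := Ultrafilter.of atTop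
  obtain ⟨ν, -, hν⟩ := isCompact_univ.ultrafilter_le_nhds (U.map P) (by simp)
  have ht : Tendsto P U (nhds ν) := hν
  refine ⟨ν, inferInstance, fun K => ?_⟩
  have h2 := ProbabilityMeasure.tendsto_measure_of_isClopen_of_tendsto ht (isClopen_evK K)
  have h3 := ENNReal.tendsto_coe.2 h2
  simp only [ProbabilityMeasure.ennreal_coeFn_eq_coeFn_toMeasure] at h3
  refine tendsto_nhds_unique h3 ?_
  apply tendsto_const_nhds.congr'
  have : ∀ᶠ J in (atTop : Filter (Finset G)), K ⊆ J := eventually_ge_atTop K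
  filter_upwards [Ultrafilter.of_le atTop this] with J hJ
  exact (nuJ_evK L hx hL hJ).symm

end Moment

section SubMeas
variable {Γ : Type*} [Group Γ]

theorem measurable_sub_iff {α : Type*} [MeasurableSpace α] {f : α → Subgroup Γ} :
    Measurable f ↔ ∀ a, MeasurableSet {x | a ∈ f x} := by
  rw [measurable_comap_iff, measurable_set_iff]
  refine forall_congr' fun a => ?_
  rw [← measurableSet_setOf]
  rfl

theorem measurableSet_mem_sub (a : Γ) : MeasurableSet {H : Subgroup Γ | a ∈ H} :=
  measurable_sub_iff.1 measurable_id a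

/-- the event that a random subgroup contains `K` -/
def evS (K : Finset Γ) : Set (Subgroup Γ) := {H | ∀ k ∈ K, k ∈ H}

theorem measurableSet_evS (K : Finset Γ) : MeasurableSet (evS K) := by
  have : evS K = ⋂ k ∈ K, {H : Subgroup Γ | k ∈ H} := by ext; simp [evS]
  rw [this]
  exact Finset.measurableSet_biInter _ fun k _ => measurableSet_mem_sub k

theorem ext_sub (μ ν : Measure (Subgroup Γ)) [IsFiniteMeasure μ]
    (h : ∀ K : Finset Γ, μ (evS K) = ν (evS K)) : μ = ν := by
  classical
  refine ext_of_generate_finite (Set.range (evS : Finset Γ → Set (Subgroup Γ))) ?_ ?_ ?_ ?_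
  · apply le_antisymm
    · have : Measurable[MeasurableSpace.generateFrom (Set.range (evS : Finset Γ → Set (Subgroup Γ))), _]
          (fun H : Subgroup Γ => (H : Set Γ)) := by
        rw [@measurable_set_iff]
        intro a
        rw [← @measurableSet_setOf]
        apply MeasurableSpace.measurableSet_generateFrom
        refine ⟨{a}, ?_⟩
        ext H; simp [evS]
      exact measurable_iff_comap_le.1 this
    · apply MeasurableSpace.generateFrom_le
      rintro _ ⟨K, rfl⟩
      exact measurableSet_evS K
  · rintro _ ⟨K, rfl⟩ _ ⟨K', rfl⟩ _
    refine ⟨K ∪ K', ?_⟩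
    ext H
    simp only [evS, Finset.mem_union, Set.mem_setOf_eq, Set.mem_inter_iff]
    constructor
    · intro h; exact ⟨fun k hk => h k (Or.inl hk), fun k hk => h k (Or.inr hk)⟩
    · rintro ⟨h1, h2⟩ k (hk | hk)
      exacts [h1 k hk, h2 k hk]
  · rintro _ ⟨K, rfl⟩; exact h K
  · have := h ∅
    have e : evS (∅ : Finset Γ) = Set.univ := by ext; simp [evS]
    rwa [e] at this

theorem mem_conjSub {g a : Γ} {H : Subgroup Γ} : a ∈ conjSub g H ↔ g⁻¹ * a * g ∈ H := by
  unfold conjSub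
  rw [Subgroup.mem_map]
  constructor
  · rintro ⟨b, hb, rfl⟩
    simpa [mul_assoc] using hb
  · intro h
    exact ⟨_, h, by simp [mul_assoc]⟩

theorem measurable_conjSub (g : Γ) : Measurable (conjSub g) := by
  rw [measurable_sub_iff]
  intro a
  simp only [mem_conjSub]
  exact measurableSet_mem_sub _

/-- the subgroup of left periods of a `0-1` function -/
def perSub (D : Γ → Bool) : Subgroup Γ where
  carrier := {g | ∀ h, D (g * h) = D h}
  one_mem' := fun h => by rw [one_mul]
  mul_mem' := fun {a b} ha hb h => by rw [mul_assoc, ha, hb]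
  inv_mem' := fun {a} ha h => by rw [← ha, mul_inv_cancel_left]

theorem measurable_perSub [Countable Γ] : Measurable (perSub : (Γ → Bool) → Subgroup Γ) := by
  rw [measurable_sub_iff]
  intro g
  have : {D : Γ → Bool | g ∈ perSub D} = ⋂ h, {D : Γ → Bool | D (g * h) = D h} := by
    ext D
    simp only [Set.mem_setOf_eq, Set.mem_iInter]
    exact Iff.rfl
  rw [this]
  exact MeasurableSet.iInter fun h => measurableSet_eq_fun (measurable_pi_apply _) (measurable_pi_apply _)

end SubMeas

namespace BratteliDiagram
variable {B : BratteliDiagram} {χ : ↥B.fullGroup → ℂ}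

/-- cylinder sets -/
def Cy (B : BratteliDiagram) : Type := {A : Set B.Path // ∃ n, Cyl n A}

instance : CommMonoid (Cy B) where
  mul a b := ⟨a.1 ∩ b.1, by
    obtain ⟨n, hn⟩ := a.2
    obtain ⟨m, hm⟩ := b.2
    exact ⟨max n m, (hn.mono (le_max_left _ _)).inter (hm.mono (le_max_right _ _))⟩⟩
  one := ⟨Set.univ, 0, fun _ _ _ _ => trivial⟩
  mul_assoc a b c := Subtype.ext (Set.inter_assoc _ _ _)
  one_mul a := Subtype.ext (Set.univ_inter _)
  mul_one a := Subtype.ext (Set.inter_univ _)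
  mul_comm a b := Subtype.ext (Set.inter_comm _ _)

theorem Cy.mul_val (a b : Cy B) : (a * b).1 = a.1 ∩ b.1 := rfl
theorem Cy.one_val : (1 : Cy B).1 = Set.univ := rfl

/-- the fixed point set as a cylinder set -/
def cy (g : ↥B.fullGroup) : Cy B := ⟨fx g, _, cyl_fx (exists_levelIn g).choose_spec⟩

/-- the value of the character on elements with the given fixed point set -/
def FF' (W : Windows B) (χ : ↥B.fullGroup → ℂ) (a : Cy B) : ℝ := (χ (W.T a.1 a.2.choose)).re

theorem FF'_eq (W : Windows B) (hχ : IsCharacter ↥B.fullGroup χ) {a : Cy B} {g : ↥B.fullGroup}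
    (h : fx g = a.1) : χ g = (FF' W χ a : ℂ) := by
  unfold FF'
  rw [chi_real W hχ]
  apply chi_fx W hχ
  rw [h, W.fx_T le_rfl a.2.choose_spec]

theorem psd_fin (W : Windows B) (hχ : IsCharacter ↥B.fullGroup χ) {M : ℕ} (C : Fin M → Cy B)
    (c : Fin M → ℝ) : 0 ≤ ∑ i, ∑ j, c i * c j * FF' W χ (C i * C j) := by
  obtain ⟨V, i1, i2, ξ, hξ⟩ := exists_gns hχ
  choose l hl using fun i => (C i).2
  let n := ∑ i, l i
  have hC : ∀ i, Cyl n (C i).1 := by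
    intro i
    exact (hl i).mono (Finset.single_le_sum (f := l) (fun _ _ => Nat.zero_le _) (Finset.mem_univ i))
  set D : ℝ := ∑ i, c i * c i * (1 - FF' W χ (C i * C i)) with hD
  set Q : ℝ := ∑ i, ∑ j, c i * c j * FF' W χ (C i * C j) with hQ
  have key : ∀ N : ℕ, 0 ≤ (N : ℝ) * N * Q + N * D := by
    intro N
    let w : Fin M × Fin N → ℕ := fun p => n + Nat.pair p.1 p.2
    have hw : ∀ p q, p ≠ q → w p ≠ w q := by
      intro p q hpq h
      have h' : Nat.pair p.1 p.2 = Nat.pair q.1 q.2 := by simp only [w] at h; omega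
      rw [Nat.pair_eq_pair] at h'
      exact hpq (Prod.ext (Fin.ext h'.1) (Fin.ext h'.2))
    let T : Fin M × Fin N → ↥B.fullGroup := fun p => W.T (C p.1).1 (w p)
    let v : V := ∑ p, ((c p.1 : ℝ) : ℂ) • ξ (T p)
    have hTT : ∀ p q, χ (T p * (T q)⁻¹) =
        ((FF' W χ (C p.1 * C q.1) + if p = q then (1 - FF' W χ (C p.1 * C p.1)) else 0 : ℝ) : ℂ) := by
      intro p q
      split_ifs with h
      · subst h
        rw [mul_inv_cancel, hχ.1]; simp
      · rw [add_zero]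
        apply FF'_eq W hχ
        simp only [T]
        rw [W.T_inv (by simp only [w]; omega) (hC q.1), Cy.mul_val]
        exact W.fx_T_T (by simp only [w]; omega) (by simp only [w]; omega) (hw p q h) (hC _) (hC _)
    have hv : inner ℂ v v = ((N * N * Q + N * D : ℝ) : ℂ) := by
      simp only [v, sum_inner, inner_sum, inner_smul_left, inner_smul_right, hξ, hTT,
        Complex.conj_ofReal]
      norm_cast
      simp only [mul_add, Finset.sum_add_distrib]
      congr 1
      · simp only [Fintype.sum_prod_type]
        simp only [Finset.sum_const, Finset.card_univ, Fintype.card_fin, nsmul_eq_mul]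
        rw [hQ]
        simp only [Finset.mul_sum]
        refine Finset.sum_congr rfl fun i _ => ?_
        refine Finset.sum_congr rfl fun j _ => ?_
        rw [mul_comm (C j)]
        push_cast
        ring
      · simp only [mul_ite, mul_zero, Finset.sum_ite_eq', Finset.mem_univ, if_true]
        simp only [Fintype.sum_prod_type, Finset.sum_const, Finset.card_univ, Fintype.card_fin,
          nsmul_eq_mul]
        rw [hD, Finset.mul_sum]
        refine Finset.sum_congr rfl fun i _ => ?_
        ring
    have h0 : 0 ≤ (inner ℂ v v).re := inner_self_nonneg (𝕜 := ℂ)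
    rw [hv, Complex.ofReal_re] at h0
    exact h0
  have hlim : Tendsto (fun N : ℕ => Q + D / N) atTop (nhds (Q + 0)) :=
    (tendsto_const_div_atTop_nhds_zero_nat D).const_add Q
  rw [add_zero] at hlim
  apply ge_of_tendsto hlim
  filter_upwards [eventually_gt_atTop 0] with N hN
  have hNr : (0:ℝ) < N := by exact_mod_cast hN
  have := key N
  have e : (N : ℝ) * N * Q + N * D = (N * N) * (Q + D / N) := by field_simp
  rw [e] at this
  exact nonneg_of_mul_nonneg_right this (by positivity)

/-- the linear functional on the algebra of cylinder sets -/
def LL (W : Windows B) (χ : ↥B.fullGroup → ℂ) : MonoidAlgebra ℝ (Cy B) →+ ℝ where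
  toFun f := f.coeff.sum fun a c => c * FF' W χ a
  map_zero' := by simp
  map_add' f g := by
    rw [MonoidAlgebra.coeff_add, Finsupp.sum_add_index']
    · simp
    · intro a b c; ring

theorem LL_single (W : Windows B) (χ : ↥B.fullGroup → ℂ) (a : Cy B) (r : ℝ) :
    LL W χ (MonoidAlgebra.single a r) = r * FF' W χ a := by
  change (MonoidAlgebra.single a r).coeff.sum (fun a c => c * FF' W χ a) = _
  simp

theorem LL_sq (W : Windows B) (hχ : IsCharacter ↥B.fullGroup χ) (f : MonoidAlgebra ℝ (Cy B)) :
    0 ≤ LL W χ (f * f) := by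
  have hf : f = ∑ a ∈ f.coeff.support, MonoidAlgebra.single a (f.coeff a) := by
    apply MonoidAlgebra.coeff_injective
    rw [MonoidAlgebra.coeff_sum]
    simp only [MonoidAlgebra.coeff_single]
    exact (Finsupp.sum_single f.coeff).symm
  have e : LL W χ (f * f) = ∑ a ∈ f.coeff.support, ∑ b ∈ f.coeff.support,
      f.coeff a * f.coeff b * FF' W χ (a * b) := by
    conv_lhs => rw [hf, Finset.sum_mul_sum]
    simp only [map_sum, MonoidAlgebra.single_mul_single, LL_single]
  rw [e]
  refine le_of_le_of_eq (psd_fin W hχ (fun i => (f.coeff.support.equivFin.symm i : Cy B))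
    (fun i => f.coeff (f.coeff.support.equivFin.symm i : Cy B))) ?_
  rw [← Finset.sum_coe_sort f.coeff.support]
  rw [← Equiv.sum_comp f.coeff.support.equivFin.symm]
  refine Finset.sum_congr rfl fun a _ => ?_
  rw [← Finset.sum_coe_sort f.coeff.support]
  rw [← Equiv.sum_comp f.coeff.support.equivFin.symm]

end BratteliDiagram

namespace BratteliDiagram
variable {B : BratteliDiagram} {χ : ↥B.fullGroup → ℂ}

theorem prod_cy_val (K : Finset ↥B.fullGroup) : (∏ k ∈ K, cy k).1 = {x | ∀ k ∈ K, x ∈ fx k} := by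
  classical
  induction K using Finset.induction_on with
  | empty => simp [Cy.one_val]
  | insert a K ha ih =>
    rw [Finset.prod_insert ha, Cy.mul_val, ih]
    ext x
    simp [cy]

theorem exists_fx (W : Windows B) (a : Cy B) : ∃ h : ↥B.fullGroup, fx h = a.1 :=
  ⟨_, W.fx_T le_rfl a.2.choose_spec⟩

theorem fx_mul_subset (g h : ↥B.fullGroup) {x : B.Path} (hg : x ∈ fx g) (hh : x ∈ fx h) :
    x ∈ fx (g * h) := by
  change (g * h) • x = x
  rw [mul_smul, show h • x = x from hh, show g • x = x from hg]

theorem exists_nu' (W : Windows B) (hχ : IsCharacter ↥B.fullGroup χ) :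
    ∃ φ : Measure (Subgroup ↥B.fullGroup), IsProbabilityMeasure φ ∧
      ∀ K : Finset ↥B.fullGroup, φ (evS K) = ENNReal.ofReal (FF' W χ (∏ k ∈ K, cy k)) := by
  classical
  let x : ↥B.fullGroup → MonoidAlgebra ℝ (Cy B) := fun g => MonoidAlgebra.of ℝ (Cy B) (cy g)
  have hcc : ∀ a : Cy B, a * a = a := fun a => Subtype.ext (Set.inter_self _)
  have hx : ∀ g, x g * x g = x g := by
    intro g
    simp only [x]
    rw [← map_mul, hcc]
  have hone : FF' W χ (1 : Cy B) = 1 := by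
    have : χ 1 = FF' W χ 1 := FF'_eq W hχ (by
      rw [Cy.one_val, Set.eq_univ_iff_forall]; intro x; exact one_smul _ x)
    rw [hχ.1] at this
    exact_mod_cast this.symm
  have hLof : ∀ a : Cy B, LL W χ (MonoidAlgebra.of ℝ (Cy B) a) = FF' W χ a := by
    intro a
    rw [MonoidAlgebra.of_apply, LL_single, one_mul]
  obtain ⟨ν, hν1, hν2⟩ := exists_nu (LL W χ) (x := x) hx (LL_sq W hχ) (by
    rw [← map_one (MonoidAlgebra.of ℝ (Cy B)), hLof, hone])
  have hνK : ∀ K : Finset ↥B.fullGroup, ν (evK K) = ENNReal.ofReal (FF' W χ (∏ k ∈ K, cy k)) := by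
    intro K
    rw [hν2, ← hLof, map_prod (MonoidAlgebra.of ℝ (Cy B))]
  have hA : ∀ (K : Finset ↥B.fullGroup) (g : ↥B.fullGroup), (∀ x, (∀ k ∈ K, x ∈ fx k) → x ∈ fx g) →
      ∀ᵐ D ∂ν, (∀ k ∈ K, D k = true) → D g = true := by
    intro K g h
    have e : (∏ k ∈ insert g K, cy k) = ∏ k ∈ K, cy k := by
      apply Subtype.ext
      rw [prod_cy_val, prod_cy_val]
      ext y
      constructor
      · intro hy k hk; exact hy k (Finset.mem_insert_of_mem hk)
      · intro hy k hk
        rcases Finset.mem_insert.1 hk with rfl | hk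
        · exact h y hy
        · exact hy k hk
    have hsub : evK (insert g K) ⊆ evK K := fun D hD k hk => hD k (Finset.mem_insert_of_mem hk)
    have hae : (evK (insert g K) : Set (↥B.fullGroup → Bool)) =ᵐ[ν] evK K :=
      ae_eq_of_subset_of_measure_ge hsub (by rw [hνK, hνK, e])
        (measurableSet_evK _).nullMeasurableSet (measure_ne_top _ _)
    filter_upwards [hae] with D hD hk
    have hD' : (D ∈ evK (insert g K)) = (D ∈ evK K) := hD
    have : D ∈ evK (insert g K) := by rw [hD']; exact hk
    exact this g (Finset.mem_insert_self _ _)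
  have hae : ∀ᵐ D ∂ν, ∀ g, g ∈ perSub D ↔ D g = true := by
    have h1 := hA ∅ 1 (fun x _ => one_smul _ x)
    have h2 : ∀ᵐ D ∂ν, ∀ g h : ↥B.fullGroup, (∀ k ∈ ({g, h} : Finset ↥B.fullGroup), D k = true) →
        D (g * h) = true := by
      rw [ae_all_iff]; intro g
      rw [ae_all_iff]; intro h
      apply hA
      intro y hy
      exact fx_mul_subset g h (hy g (by simp)) (hy h (by simp))
    have h3 : ∀ᵐ D ∂ν, ∀ g h : ↥B.fullGroup, (∀ k ∈ ({g, g * h} : Finset ↥B.fullGroup), D k = true) →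
        D h = true := by
      rw [ae_all_iff]; intro g
      rw [ae_all_iff]; intro h
      apply hA
      intro y hy
      have e1 : g • y = y := hy g (by simp)
      have e2 : (g * h) • y = y := hy (g * h) (by simp)
      change h • y = y
      rw [mul_smul] at e2
      exact smul_left_cancel g (e2.trans e1.symm)
    filter_upwards [h1, h2, h3] with D h1 h2 h3 g
    constructor
    · intro hg
      have := hg 1
      rw [mul_one] at this
      rw [this]
      exact h1 (by simp)
    · intro hg h
      rw [Bool.eq_iff_iff]
      constructor
      · intro hh
        exact h3 g h (by simp [hg, hh])
      · intro hh
        exact h2 g h (by simp [hg, hh])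
  refine ⟨ν.map perSub, Measure.isProbabilityMeasure_map measurable_perSub.aemeasurable, fun K => ?_⟩
  rw [Measure.map_apply measurable_perSub (measurableSet_evS K), ← hνK]
  apply measure_congr
  filter_upwards [hae] with D hD
  change (D ∈ perSub ⁻¹' evS K) = (D ∈ evK K)
  simp only [evS, evK, Set.mem_preimage, Set.mem_setOf_eq, hD]

theorem FF'_nonneg (W : Windows B) (hχ : IsCharacter ↥B.fullGroup χ) (a : Cy B) :
    0 ≤ FF' W χ a := by
  have := psd_fin W hχ (M := 1) (fun _ => a) (fun _ => 1)
  have hcc : a * a = a := Subtype.ext (Set.inter_self _)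
  simpa [hcc] using this

theorem FF'_mono (W : Windows B) (hχ : IsCharacter ↥B.fullGroup χ) {a b : Cy B} (h : a.1 ⊆ b.1) :
    FF' W χ a ≤ FF' W χ b := by
  have := psd_fin W hχ (M := 2) ![a, b] ![1, -1]
  have h1 : a * a = a := Subtype.ext (Set.inter_self _)
  have h2 : b * b = b := Subtype.ext (Set.inter_self _)
  have h3 : a * b = a := Subtype.ext (Set.inter_eq_left.2 h)
  have h4 : b * a = a := by rw [mul_comm, h3]
  simp [Fin.sum_univ_two, h1, h2, h3, h4] at this
  exact this

theorem exists_IRS (W : Windows B) (hχ : IsCharacter ↥B.fullGroup χ) :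
    ∃ φ : Measure (Subgroup ↥B.fullGroup), IsIRS ↥B.fullGroup φ ∧
      ∀ g : ↥B.fullGroup, χ g = ((φ {H : Subgroup ↥B.fullGroup | g ∈ H}).toReal : ℂ) := by
  classical
  obtain ⟨φ, hφ, hφK⟩ := exists_nu' W hχ
  refine ⟨φ, ⟨hφ, ?_⟩, ?_⟩
  · intro g s hs
    have : φ.map (conjSub g) = φ := by
      have : IsProbabilityMeasure (φ.map (conjSub g)) :=
        Measure.isProbabilityMeasure_map (measurable_conjSub g).aemeasurable
      apply ext_sub
      intro K
      rw [Measure.map_apply (measurable_conjSub g) (measurableSet_evS K)]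
      have e : conjSub g ⁻¹' evS K = evS (K.image fun k => g⁻¹ * k * g) := by
        ext H
        simp only [evS, Set.mem_preimage, Set.mem_ofPred_eq, mem_conjSub, Finset.forall_mem_image]
      rw [e, hφK, hφK]
      congr 1
      obtain ⟨h, hh⟩ := exists_fx W (∏ k ∈ K, cy k)
      have c1 := FF'_eq W hχ hh
      have hh' : fx (g⁻¹ * h * g) = (∏ k ∈ K.image (fun k => g⁻¹ * k * g), cy k).1 := by
        rw [prod_cy_val] at hh ⊢
        have key : ∀ (k : ↥B.fullGroup) (y : B.Path), y ∈ fx (g⁻¹ * k * g) ↔ g • y ∈ fx k := by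
          intro k y
          change (g⁻¹ * k * g) • y = y ↔ k • g • y = g • y
          rw [mul_smul, mul_smul, inv_smul_eq_iff]
        ext y
        rw [key, hh]
        simp only [Set.mem_ofPred_eq, Finset.forall_mem_image, key]
      have c2 := FF'_eq W hχ hh'
      have c3 := hχ.conj g⁻¹ h
      rw [inv_inv] at c3
      rw [c3, c1] at c2
      exact_mod_cast c2.symm
    rw [← Measure.map_apply (measurable_conjSub g) hs, this]
  · intro g
    have e : {H : Subgroup ↥B.fullGroup | g ∈ H} = evS {g} := by ext; simp [evS]
    rw [e, hφK, Finset.prod_singleton, ENNReal.toReal_ofReal (FF'_nonneg W hχ _)]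
    exact FF'_eq W hχ rfl

end BratteliDiagram

namespace BratteliDiagram
variable {B : BratteliDiagram} {χ : ↥B.fullGroup → ℂ}

/-- the pointwise fixator of `A` -/
def fixA (A : Set B.Path) : Subgroup ↥B.fullGroup where
  carrier := {γ | A ⊆ fx γ}
  one_mem' := fun x _ => one_smul _ x
  mul_mem' := fun {a b} ha hb x hx => fx_mul_subset a b (ha hx) (hb hx)
  inv_mem' := fun {a} ha x hx => by
    change a⁻¹ • x = x
    rw [inv_smul_eq_iff]
    exact (ha hx).symm

theorem mem_fixA {A : Set B.Path} {γ : ↥B.fullGroup} : γ ∈ fixA A ↔ A ⊆ fx γ := Iff.rfl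

theorem comm_sq {G : Type*} [Group G] {a b : G} (h : a * b = b * a) (ha : a * a = 1)
    (hb : b * b = 1) : a * b * (a * b) = 1 := by
  calc a * b * (a * b) = a * b * (b * a) := by rw [h]
    _ = a * (b * b) * a := by simp only [mul_assoc]
    _ = 1 := by rw [hb, mul_one, ha]

theorem normal_eq_top (W : Windows B) {n : ℕ} {A : Set B.Path} (hA : Cyl n A)
    (N : Subgroup (fixA A)) [N.Normal] [N.FiniteIndex] : N = ⊤ := by
  have hT : ∀ j, n ≤ j → W.T A j ∈ fixA A := fun j hj => (W.fx_T hj hA).ge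
  obtain ⟨i, j, hij, he⟩ := Finite.exists_ne_map_eq_of_infinite
    (fun j : ℕ => ((⟨W.T A (n + j), hT _ (Nat.le_add_right _ _)⟩ : fixA A) : fixA A ⧸ N))
  have hi : n ≤ n + i := Nat.le_add_right _ _
  have hj : n ≤ n + j := Nat.le_add_right _ _
  have hne : n + i ≠ n + j := by omega
  have hmem := QuotientGroup.eq.1 he
  have hinv : (W.T A (n + i))⁻¹ = W.T A (n + i) := inv_eq_of_mul_eq_one_left (W.T_sq hi hA)
  have hf := W.fx_T_T hi hj hne hA hA
  rw [Set.inter_self] at hf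
  have hsq : (W.T A (n + i) * W.T A (n + j)) * (W.T A (n + i) * W.T A (n + j)) = 1 :=
    comm_sq (W.T_comm hi hj hA hA) (W.T_sq hi hA) (W.T_sq hj hA)
  have h1 : ∀ (s : ↥B.fullGroup), s * s = 1 → ∀ (e : fx s = A) (hs : s ∈ fixA A), (⟨s, hs⟩ : fixA A) ∈ N := by
    intro s hs e hs'
    obtain ⟨θ, hθ, hc⟩ := W.conj_inv hsq hs (hf.trans e.symm)
    rw [hf] at hθ
    have := Subgroup.Normal.conj_mem ‹N.Normal› _ hmem ⟨θ, hθ⟩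
    convert this using 1
    apply Subtype.ext
    change s = θ * ((W.T A (n + i))⁻¹ * W.T A (n + j)) * θ⁻¹
    rw [hinv, hc]
  have h2 : ∀ (s : ↥B.fullGroup), s * s = 1 → ∀ (hs : s ∈ fixA A), (⟨s, hs⟩ : fixA A) ∈ N := by
    intro s hs hs'
    obtain ⟨m, hm⟩ := exists_levelIn s
    have hA' : Cyl (max n m) A := hA.mono (le_max_left _ _)
    have hm' := levelIn_mono (le_max_right n m) hm
    have e := W.fx_mul_T le_rfl hm' hA' hs'
    have ht := W.fx_T le_rfl hA'
    have hc : s * W.T A (max n m) = W.T A (max n m) * s :=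
      W.T_smul_comm le_rfl hm' hA' hs'
    have m1 := h1 (s * W.T A (max n m)) (comm_sq hc hs (W.T_sq le_rfl hA')) e e.ge
    have m2 := h1 (W.T A (max n m)) (W.T_sq le_rfl hA') ht ht.ge
    have := N.mul_mem m1 m2
    convert this using 1
    apply Subtype.ext
    change s = s * W.T A (max n m) * W.T A (max n m)
    rw [mul_assoc, W.T_sq le_rfl hA', mul_one]
  rw [eq_top_iff]
  rintro ⟨γ, hγ⟩ _
  obtain ⟨m, hm⟩ := exists_levelIn γ
  have hcl := mem_closure_inv γ hm hγ
  have : Subgroup.closure (invSet m A) ≤ N.map (fixA A).subtype := by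
    rw [Subgroup.closure_le]
    rintro s ⟨_, hs, hsA⟩
    exact ⟨⟨s, hsA⟩, h2 s hs hsA, rfl⟩
  obtain ⟨y, hy, he⟩ := this hcl
  have : y = ⟨γ, hγ⟩ := Subtype.ext he
  rwa [← this]

theorem exists_distinct (W : Windows B) {n : ℕ} {A : Set B.Path} (hA : Cyl n A)
    (H : Subgroup ↥B.fullGroup) (hH : ¬ ∀ γ, A ⊆ fx γ → γ ∈ H) (N : ℕ) :
    ∃ x : Fin N → ↥B.fullGroup, (∀ i, A ⊆ fx (x i)) ∧ ∀ i j, i ≠ j → (x i)⁻¹ * x j ∉ H := by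
  have hinf : Infinite (fixA A ⧸ H.subgroupOf (fixA A)) := by
    by_contra hfin
    rw [not_infinite_iff_finite] at hfin
    have : (H.subgroupOf (fixA A)).FiniteIndex := Subgroup.finiteIndex_of_finite_quotient
    have h1 := normal_eq_top W hA (H.subgroupOf (fixA A)).normalCore
    apply hH
    intro γ hγ
    have h2 : (⟨γ, hγ⟩ : fixA A) ∈ (H.subgroupOf (fixA A)).normalCore := by rw [h1]; trivial
    exact Subgroup.normalCore_le (H.subgroupOf (fixA A)) h2
  let f : ℕ ↪ (fixA A ⧸ H.subgroupOf (fixA A)) := Infinite.natEmbedding _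
  refine ⟨fun i => (Quotient.out (f i)).1, fun i => (Quotient.out (f i)).2, ?_⟩
  intro i j hij hmem
  have h3 : (Quotient.out (f i))⁻¹ * Quotient.out (f j) ∈ H.subgroupOf (fixA A) := hmem
  have h4 := QuotientGroup.eq.2 h3
  rw [QuotientGroup.out_eq', QuotientGroup.out_eq'] at h4
  exact hij (Fin.ext (f.injective h4))

/-- the finite set of level `m` elements fixing `A` -/
def finA (A : Set B.Path) (m : ℕ) : Finset ↥B.fullGroup :=
  (show ({γ | γ ∈ B.levelIn m ∧ A ⊆ fx γ} : Set ↥B.fullGroup).Finite from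
    (show (B.levelIn m : Set ↥B.fullGroup).Finite from finite_levelIn m).subset fun _ h => h.1).toFinset

theorem mem_finA {A : Set B.Path} {m : ℕ} {γ : ↥B.fullGroup} :
    γ ∈ finA A m ↔ γ ∈ B.levelIn m ∧ A ⊆ fx γ := by
  simp only [finA, Set.Finite.mem_toFinset, Set.mem_ofPred_eq]

theorem card_le (A : Set B.Path) (H : Subgroup ↥B.fullGroup) {N m : ℕ} (x : Fin N → ↥B.fullGroup)
    (h1 : ∀ i, x i ∈ finA A m) (h2 : ∀ i j, i ≠ j → (x i)⁻¹ * x j ∉ H)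
    (S : Finset ↥B.fullGroup) (hS : ∀ γ, γ ∈ S ↔ γ ∈ finA A m ∧ γ ∈ H) :
    N * S.card ≤ (finA A m).card := by
  classical
  have : ((Finset.univ : Finset (Fin N)) ×ˢ S).card ≤ (finA A m).card := by
    apply Finset.card_le_card_of_injOn (fun p => x p.1 * p.2)
    · rintro ⟨i, γ⟩ hp
      have hγ := (hS γ).1 (Finset.mem_product.1 hp).2
      have a := mem_finA.1 (h1 i)
      have b := mem_finA.1 hγ.1
      exact mem_finA.2 ⟨mul_mem a.1 b.1, (fixA A).mul_mem a.2 b.2⟩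
    · rintro ⟨i, γ⟩ hp ⟨j, γ'⟩ hp' he
      have hγ := ((hS γ).1 (Finset.mem_product.1 hp).2).2
      have hγ' := ((hS γ').1 (Finset.mem_product.1 hp').2).2
      have he' : x i * γ = x j * γ' := he
      have hij : i = j := by
        by_contra hne
        apply h2 i j hne
        have : (x i)⁻¹ * x j = γ * γ'⁻¹ := by
          rw [inv_mul_eq_iff_eq_mul, ← mul_assoc, he', mul_inv_cancel_right]
        rw [this]
        exact mul_mem hγ (inv_mem hγ')
      subst hij
      rw [mul_left_cancel he']
  simpa using this

open Classical in
/-- proportion of `finA A m` inside `H` -/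
def rat (A : Set B.Path) (m : ℕ) (H : Subgroup ↥B.fullGroup) : ℝ :=
  (∑ γ ∈ finA A m, {H : Subgroup ↥B.fullGroup | γ ∈ H}.indicator (fun _ => (1 : ℝ)) H) /
    (finA A m).card

theorem finA_pos (A : Set B.Path) (m : ℕ) : 0 < ((finA A m).card : ℝ) := by
  have : (1 : ↥B.fullGroup) ∈ finA A m := mem_finA.2 ⟨one_mem _, (fixA A).one_mem⟩
  exact_mod_cast Finset.card_pos.2 ⟨_, this⟩

theorem rat_eq [DecidableEq ↥B.fullGroup] (A : Set B.Path) (m : ℕ) (H : Subgroup ↥B.fullGroup)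
    [DecidablePred (· ∈ H)] :
    rat A m H = (((finA A m).filter (· ∈ H)).card : ℝ) / (finA A m).card := by
  unfold rat
  congr 1
  rw [Finset.card_filter]
  push_cast
  refine Finset.sum_congr rfl fun γ _ => ?_
  by_cases h : γ ∈ H
  · rw [Set.indicator_of_mem (by exact h), if_pos h]
  · rw [Set.indicator_of_notMem (by exact h), if_neg h]

theorem rat_nonneg (A : Set B.Path) (m : ℕ) (H : Subgroup ↥B.fullGroup) : 0 ≤ rat A m H := by
  classical
  rw [rat_eq]; positivity

theorem rat_le_one (A : Set B.Path) (m : ℕ) (H : Subgroup ↥B.fullGroup) : rat A m H ≤ 1 := by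
  classical
  rw [rat_eq, div_le_one (finA_pos A m)]
  exact_mod_cast Finset.card_filter_le _ _

theorem rat_tendsto (W : Windows B) {n : ℕ} {A : Set B.Path} (hA : Cyl n A)
    (H : Subgroup ↥B.fullGroup) :
    Tendsto (fun m => rat A m H) atTop
      (nhds ({H : Subgroup ↥B.fullGroup | ∀ γ, A ⊆ fx γ → γ ∈ H}.indicator (fun _ => (1 : ℝ)) H)) := by
  classical
  by_cases hH : ∀ γ, A ⊆ fx γ → γ ∈ H
  · rw [Set.indicator_of_mem (by exact hH)]
    have : ∀ m, rat A m H = 1 := by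
      intro m
      rw [rat_eq, Finset.filter_true_of_mem (fun γ hγ => hH γ (mem_finA.1 hγ).2)]
      exact div_self (finA_pos A m).ne'
    simp only [this]
    exact tendsto_const_nhds
  · rw [Set.indicator_of_notMem (by exact hH)]
    rw [Metric.tendsto_atTop]
    intro ε hε
    obtain ⟨N, hN⟩ := exists_nat_one_div_lt hε
    obtain ⟨x, hx1, hx2⟩ := exists_distinct W hA H hH (N + 1)
    choose l hl using fun i => exists_levelIn (x i)
    refine ⟨∑ i, l i, fun m hm => ?_⟩
    have hx3 : ∀ i, x i ∈ finA A m := fun i => mem_finA.2 ⟨levelIn_mono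
      ((Finset.single_le_sum (fun _ _ => Nat.zero_le _) (Finset.mem_univ i)).trans hm) (hl i), hx1 i⟩
    have := card_le A H x hx3 hx2 ((finA A m).filter (· ∈ H)) (fun γ => Finset.mem_filter)
    rw [Real.dist_eq, sub_zero, abs_of_nonneg (rat_nonneg _ _ _)]
    refine lt_of_le_of_lt ?_ hN
    rw [rat_eq, div_le_div_iff₀ (finA_pos A m) (by positivity)]
    have h' : (((N + 1 : ℕ) * ((finA A m).filter (· ∈ H)).card : ℕ) : ℝ) ≤ (finA A m).card := by
      exact_mod_cast this
    push_cast at h'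
    linarith

theorem measurable_all (A : Set B.Path) :
    MeasurableSet {H : Subgroup ↥B.fullGroup | ∀ γ, A ⊆ fx γ → γ ∈ H} := by
  have : {H : Subgroup ↥B.fullGroup | ∀ γ, A ⊆ fx γ → γ ∈ H} =
      ⋂ (γ : ↥B.fullGroup) (_ : A ⊆ fx γ), {H : Subgroup ↥B.fullGroup | γ ∈ H} := by
    ext H
    simp only [Set.mem_iInter, Set.mem_ofPred_eq]
  rw [this]
  exact MeasurableSet.iInter fun γ => MeasurableSet.iInter fun _ => measurableSet_mem_sub γ

theorem measure_all (W : Windows B) (hχ : IsCharacter ↥B.fullGroup χ)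
    (φ : Measure (Subgroup ↥B.fullGroup)) [IsProbabilityMeasure φ]
    (hφ : ∀ g : ↥B.fullGroup, χ g = ((φ {H : Subgroup ↥B.fullGroup | g ∈ H}).toReal : ℂ))
    (g : ↥B.fullGroup) :
    φ {H : Subgroup ↥B.fullGroup | g ∈ H} ≤
      φ {H : Subgroup ↥B.fullGroup | ∀ γ, fx g ⊆ fx γ → γ ∈ H} := by
  obtain ⟨n, hn⟩ := exists_levelIn g
  have hA := cyl_fx hn
  have hF : ∀ γ, φ.real {H : Subgroup ↥B.fullGroup | γ ∈ H} = FF' W χ (cy γ) := by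
    intro γ
    have := hφ γ
    rw [FF'_eq W hχ (g := γ) (a := cy γ) rfl] at this
    exact_mod_cast this.symm
  have hInteg : ∀ γ : ↥B.fullGroup, Integrable
      ({H : Subgroup ↥B.fullGroup | γ ∈ H}.indicator (fun _ => (1 : ℝ))) φ := fun γ =>
    (integrable_const (1 : ℝ)).indicator (measurableSet_mem_sub γ)
  have hm : ∀ m, Integrable (rat (fx g) m) φ := by
    intro m
    unfold rat
    exact (integrable_finsetSum _ fun γ _ => hInteg γ).div_const _
  have hI : ∀ m, FF' W χ (cy g) ≤ ∫ H, rat (fx g) m H ∂φ := by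
    intro m
    unfold rat
    rw [integral_div, integral_finsetSum _ fun γ _ => hInteg γ, le_div_iff₀ (finA_pos _ m)]
    have : ∀ γ ∈ finA (fx g) m, FF' W χ (cy g) ≤
        ∫ H, {H : Subgroup ↥B.fullGroup | γ ∈ H}.indicator (fun _ => (1 : ℝ)) H ∂φ := by
      intro γ hγ
      rw [integral_indicator_const _ (measurableSet_mem_sub γ), smul_eq_mul, mul_one, hF]
      exact FF'_mono W hχ (mem_finA.1 hγ).2
    have := Finset.sum_le_sum this
    rw [Finset.sum_const, nsmul_eq_mul] at this
    linarith
  have hlim := tendsto_integral_of_dominated_convergence (μ := φ) (F := fun m => rat (fx g) m)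
    (fun _ => (1 : ℝ)) (fun m => (hm m).aestronglyMeasurable) (integrable_const _)
    (fun m => Eventually.of_forall fun H => by
      rw [Real.norm_eq_abs, abs_of_nonneg (rat_nonneg _ _ _)]; exact rat_le_one _ _ _)
    (Eventually.of_forall fun H => rat_tendsto W hA H)
  have := ge_of_tendsto' hlim hI
  rw [integral_indicator_const _ (measurable_all _), smul_eq_mul, mul_one, ← hF] at this
  exact (ENNReal.toReal_le_toReal (measure_ne_top _ _) (measure_ne_top _ _)).1 this

theorem ae_star (W : Windows B) (hχ : IsCharacter ↥B.fullGroup χ)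
    (φ : Measure (Subgroup ↥B.fullGroup)) [IsProbabilityMeasure φ]
    (hφ : ∀ g : ↥B.fullGroup, χ g = ((φ {H : Subgroup ↥B.fullGroup | g ∈ H}).toReal : ℂ)) :
    ∀ᵐ H ∂φ, ∀ g : ↥B.fullGroup, g ∈ H → ∀ γ, fx g ⊆ fx γ → γ ∈ H := by
  rw [ae_all_iff]
  intro g
  have hae : ({H : Subgroup ↥B.fullGroup | ∀ γ, fx g ⊆ fx γ → γ ∈ H} : Set _) =ᵐ[φ]
      {H : Subgroup ↥B.fullGroup | g ∈ H} :=
    ae_eq_of_subset_of_measure_ge (fun H hH => hH g subset_rfl) (measure_all W hχ φ hφ g)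
      (measurable_all _).nullMeasurableSet (measure_ne_top _ _)
  filter_upwards [hae] with H hH hg
  have h' : (H ∈ {H : Subgroup ↥B.fullGroup | ∀ γ, fx g ⊆ fx γ → γ ∈ H}) =
    (H ∈ {H : Subgroup ↥B.fullGroup | g ∈ H}) := hH
  have : H ∈ {H : Subgroup ↥B.fullGroup | ∀ γ, fx g ⊆ fx γ → γ ∈ H} := by rw [h']; exact hg
  exact this

theorem star_evS (W : Windows B) {H : Subgroup ↥B.fullGroup}
    (hH : ∀ g : ↥B.fullGroup, g ∈ H → ∀ γ, fx g ⊆ fx γ → γ ∈ H) (K : Finset ↥B.fullGroup) :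
    (∀ k ∈ K, k ∈ H) → ∀ h : ↥B.fullGroup, fx h = (∏ k ∈ K, cy k).1 → h ∈ H := by
  classical
  induction K using Finset.induction_on with
  | empty =>
    intro _ h hh
    have : h = 1 := by
      apply group_ext
      intro x
      have hx : x ∈ fx h := by rw [hh, Finset.prod_empty, Cy.one_val]; trivial
      rw [one_smul]; exact hx
    rw [this]; exact one_mem _
  | insert a K ha ih =>
    intro hK h hh
    obtain ⟨h', hh'⟩ := exists_fx W (∏ k ∈ K, cy k)
    have m1 := ih (fun k hk => hK k (Finset.mem_insert_of_mem hk)) h' hh'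
    have m2 := hK a (Finset.mem_insert_self _ _)
    obtain ⟨n, hn⟩ := exists_levelIn a
    obtain ⟨n', hn'⟩ := exists_levelIn h'
    have c1 := (cyl_fx hn).mono (le_max_left n n')
    have c2 := (cyl_fx hn').mono (le_max_right n n')
    set q := max n n'
    have t1 := hH a m2 (W.T (fx a) q) (W.fx_T le_rfl c1).ge
    have t2 := hH h' m1 (W.T (fx h') (q + 1)) (W.fx_T (Nat.le_succ q) c2).ge
    have hf := W.fx_T_T le_rfl (Nat.le_succ q) (Nat.lt_succ_self q).ne c1 c2
    refine hH _ (mul_mem t1 t2) h ?_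
    rw [Finset.prod_insert ha, Cy.mul_val, ← hh'] at hh
    rw [hh]
    exact hf.le

theorem measure_evS (W : Windows B) (hχ : IsCharacter ↥B.fullGroup χ)
    (φ : Measure (Subgroup ↥B.fullGroup)) [IsProbabilityMeasure φ]
    (hφ : ∀ g : ↥B.fullGroup, χ g = ((φ {H : Subgroup ↥B.fullGroup | g ∈ H}).toReal : ℂ))
    (K : Finset ↥B.fullGroup) : φ (evS K) = ENNReal.ofReal (FF' W χ (∏ k ∈ K, cy k)) := by
  obtain ⟨h, hh⟩ := exists_fx W (∏ k ∈ K, cy k)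
  have e1 : φ (evS K) = φ {H : Subgroup ↥B.fullGroup | h ∈ H} := by
    apply measure_congr
    filter_upwards [ae_star W hχ φ hφ] with H hH
    apply propext
    constructor
    · intro hK
      exact star_evS W hH K hK h hh
    · intro hm k hk
      refine hH h hm k ?_
      rw [hh, prod_cy_val]
      intro x hx
      exact hx k hk
  have e2 := hφ h
  rw [FF'_eq W hχ hh] at e2
  have e3 : FF' W χ (∏ k ∈ K, cy k) = (φ {H : Subgroup ↥B.fullGroup | h ∈ H}).toReal := by
    exact_mod_cast e2
  rw [e1, e3, ENNReal.ofReal_toReal (measure_ne_top _ _)]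

theorem main_exists_unique (heven : B.IsEven) (hχ : IsCharacter ↥B.fullGroup χ) :
    ∃! φ : Measure (Subgroup ↥B.fullGroup), IsIRS ↥B.fullGroup φ ∧
      ∀ g : ↥B.fullGroup, χ g = ((φ {H : Subgroup ↥B.fullGroup | g ∈ H}).toReal : ℂ) := by
  obtain ⟨W⟩ := exists_windows B heven
  obtain ⟨φ, hφ, hφ'⟩ := exists_IRS W hχ
  refine ⟨φ, ⟨hφ, hφ'⟩, ?_⟩
  rintro ψ ⟨hψ, hψ'⟩
  have := hφ.1
  have := hψ.1
  apply ext_sub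
  intro K
  rw [measure_evS W hχ ψ hψ', measure_evS W hχ φ hφ']

end BratteliDiagram

/-- every character of a simple (even) AF full group with finitely many ergodic
measures is of the form `χ(g) = φ({H : g ∈ H})` for a unique invariant random subgroup `φ`. -/
theorem character_eq_IRS (B : BratteliDiagram)
    (hsimple : B.IsSimple) (heven : B.IsEven)
    (hfin : {ν : Measure B.Path |
      IsProbabilityMeasure ν ∧ MeasInv ↥B.fullGroup ν ∧ MeasErg ↥B.fullGroup ν}.Finite)
    (χ : ↥B.fullGroup → ℂ) (hχ : IsCharacter ↥B.fullGroup χ) :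
    ∃! φ : Measure (Subgroup ↥B.fullGroup), IsIRS ↥B.fullGroup φ ∧
      ∀ g : ↥B.fullGroup, χ g = ((φ {H : Subgroup ↥B.fullGroup | g ∈ H}).toReal : ℂ) := by
  exact BratteliDiagram.main_exists_unique heven hχ
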